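/- Let R be a commutative Noetherian semiperfect ring and C a semidualizing R-module with id_{R_p}(C_p) < ∞ for all p ∈ X^{n-1}(R), where n is a positive integer. Let M be a finitely generated R-module in the Bass class B_C which is horizontally linked with respect to C. Then the following are equivalent: (i) M satisfies (S̃_n); (ii) M is an n-th C-syzygy module; (iii) Ext^i_R(λ_R(C,M), C) = 0 for 0 < i < n; (iv) Ext^i_{P_C}(λ_R(C,M), C) = 0 for 0 < i < n (equivalently, Ext^i_R(Hom_R(C, λ_R(C,M)), R) = 0 for 0 < i < n). -/

import Mathlib

/- Preliminary definitions for formalizing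
   "Linkage of modules with respect to a semidualizing module"
   (Dibaei–Sadeghi). -/

open CategoryTheory

universe u
noncomputable section
namespace Paper

variable (R : Type u) [CommRing R]

/-- `Ext^i_R(M,N)`, realized via Mathlib's derived-functor `Ext` for the
`R`-linear abelian category of `R`-modules. -/
abbrev ExtGrp (M N : Type u) [AddCommGroup M] [Module R M] [AddCommGroup N] [Module R N]
    (i : ℕ) : Type u :=
  ((Ext R (ModuleCat.{u} R) i).obj (Opposite.op (ModuleCat.of R M))).obj (ModuleCat.of R N)

/-- `Tor^R_i(M,N)`. -/
abbrev TorGrp (M N : Type u) [AddCommGroup M] [Module R M] [AddCommGroup N] [Module R N]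
    (i : ℕ) : Type u :=
  ((Tor (ModuleCat.{u} R) i).obj (ModuleCat.of R M)).obj (ModuleCat.of R N)

/-- Local cohomology `H^i_I(M)`. -/
abbrev LocCoh (I : Ideal R) (i : ℕ) (M : Type u) [AddCommGroup M] [Module R M] : Type u :=
  (localCohomology I i).obj (ModuleCat.of R M)

/-- A commutative ring is semiperfect iff it is a finite direct product of
commutative local rings. -/
def IsSemiperfectRing : Prop :=
  ∃ (n : ℕ) (A : Fin n → Type u) (c : ∀ i, CommRing (A i)),
    (∀ i, letI := c i; IsLocalRing (A i)) ∧
    (letI := c; Nonempty (R ≃+* ((i : Fin n) → A i)))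

/-- `C` is a semidualizing `R`-module: `C` is finitely generated, the homothety map
`R → Hom_R(C,C)` is bijective, and `Ext^i_R(C,C) = 0` for all `i > 0`. -/
def IsSemidualizing (C : Type u) [AddCommGroup C] [Module R C] : Prop :=
  Module.Finite R C ∧
  Function.Bijective (LinearMap.lsmul R C) ∧
  ∀ i : ℕ, 0 < i → Subsingleton (ExtGrp R C C i)

/-- A minimal projective presentation `P₁ → P₀ → M → 0` of `M`:
both `P₀ → M` and the induced `P₁ → ker(P₀ → M)` are projective covers
(surjections from finitely generated projectives with superfluous kernels). -/
structure MinPres (M : Type u) [AddCommGroup M] [Module R M] where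
  P₁ : Type u
  P₀ : Type u
  [acg₁ : AddCommGroup P₁]
  [acg₀ : AddCommGroup P₀]
  [mod₁ : Module R P₁]
  [mod₀ : Module R P₀]
  f : P₁ →ₗ[R] P₀
  g : P₀ →ₗ[R] M
  finite₁ : Module.Finite R P₁
  finite₀ : Module.Finite R P₀
  proj₁ : Module.Projective R P₁
  proj₀ : Module.Projective R P₀
  surj : Function.Surjective g
  exact : LinearMap.range f = LinearMap.ker g
  min₀ : ∀ N : Submodule R P₀, N ⊔ LinearMap.ker g = ⊤ → N = ⊤
  min₁ : ∀ N : Submodule R P₁, N ⊔ LinearMap.ker f = ⊤ → N = ⊤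

attribute [instance] MinPres.acg₁ MinPres.acg₀ MinPres.mod₁ MinPres.mod₀

variable {R}

/-- Given a minimal presentation `P₁ --f--> P₀ → X → 0` this is
`Hom(f,C) : Hom_R(P₀,C) → Hom_R(P₁,C)`; its image is `Ω_C Tr_C X` and its
cokernel is the transpose `Tr_C X` of `X` with respect to `C`. -/
def MinPres.homC {X : Type u} [AddCommGroup X] [Module R X]
    (C : Type u) [AddCommGroup C] [Module R C] (pres : MinPres R X) :
    (pres.P₀ →ₗ[R] C) →ₗ[R] (pres.P₁ →ₗ[R] C) :=
  LinearMap.lcomp R C pres.f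

/-- `Tr_C X` computed from a given minimal presentation. -/
def MinPres.trC {X : Type u} [AddCommGroup X] [Module R X]
    (C : Type u) [AddCommGroup C] [Module R C] (pres : MinPres R X) : Type u :=
  (pres.P₁ →ₗ[R] C) ⧸ LinearMap.range (pres.homC C)

instance {X : Type u} [AddCommGroup X] [Module R X] (C : Type u) [AddCommGroup C] [Module R C]
    (pres : MinPres R X) : AddCommGroup (pres.trC C) :=
  inferInstanceAs (AddCommGroup ((pres.P₁ →ₗ[R] C) ⧸ LinearMap.range (pres.homC C)))

instance {X : Type u} [AddCommGroup X] [Module R X] (C : Type u) [AddCommGroup C] [Module R C]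
    (pres : MinPres R X) : Module R (pres.trC C) :=
  inferInstanceAs (Module R ((pres.P₁ →ₗ[R] C) ⧸ LinearMap.range (pres.homC C)))

variable (R)

/-- `N ≅ Ω_C Tr_C X` : `N` is (isomorphic to) the image of `Hom(f,C)` for a
minimal projective presentation `P₁ --f--> P₀ → X → 0` of `X`. -/
def IsOmegaTrC (C : Type u) [AddCommGroup C] [Module R C]
    (X : Type u) [AddCommGroup X] [Module R X]
    (N : Type u) [AddCommGroup N] [Module R N] : Prop :=
  ∃ pres : MinPres R X, Nonempty (N ≃ₗ[R] ↥(LinearMap.range (pres.homC C)))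

/-- `N ≅ λ_R(C,M) = Ω_C Tr_C (Hom_R(C,M))`. -/
def IsLambdaOf (C : Type u) [AddCommGroup C] [Module R C]
    (M : Type u) [AddCommGroup M] [Module R M]
    (N : Type u) [AddCommGroup N] [Module R N] : Prop :=
  IsOmegaTrC R C (C →ₗ[R] M) N

/-- `M` is horizontally linked with respect to `C` : `M ≅ λ_R(C, λ_R(C,M))`. -/
def IsHorizontallyLinked (C : Type u) [AddCommGroup C] [Module R C]
    (M : Type u) [AddCommGroup M] [Module R M] : Prop :=
  ∃ N : ModuleCat.{u} R, IsLambdaOf R C M N ∧ IsLambdaOf R C N M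

/-- `M` is horizontally linked in the sense of Martsinkovsky–Strooker:
`M ≅ λ(λ M)` where `λ = Ω Tr`. -/
def IsHorizontallyLinkedMS (M : Type u) [AddCommGroup M] [Module R M] : Prop :=
  ∃ N : ModuleCat.{u} R, IsOmegaTrC R R M N ∧ IsOmegaTrC R R N M

/-- `underline-Hom_R(M,N) = 0` : every homomorphism `M → N` factors through a
projective module. -/
def StableHomZero (M N : Type u) [AddCommGroup M] [Module R M]
    [AddCommGroup N] [Module R N] : Prop :=
  ∀ φ : M →ₗ[R] N, ∃ P : ModuleCat.{u} R, Module.Projective R P ∧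
    ∃ (α : M →ₗ[R] P) (β : (P : Type u) →ₗ[R] N), β ∘ₗ α = φ

/-- `M` is `C`-stable: `M` has no nonzero direct summand of the form `P ⊗_R C`
with `P` projective. -/
def IsCStable (C M : Type u) [AddCommGroup C] [Module R C]
    [AddCommGroup M] [Module R M] : Prop :=
  ∀ N₁ N₂ : Submodule R M, IsCompl N₁ N₂ →
    ∀ P : ModuleCat.{u} R, Module.Projective R P →
      Nonempty (↥N₁ ≃ₗ[R] TensorProduct R P C) → N₁ = ⊥

/-- `M` is a `C`-syzygy: `M` embeds into a module `P ⊗_R C` with `P` projective. -/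
def IsCSyzygy (C M : Type u) [AddCommGroup C] [Module R C]
    [AddCommGroup M] [Module R M] : Prop :=
  ∃ P : ModuleCat.{u} R, Module.Projective R P ∧
    ∃ ι : M →ₗ[R] TensorProduct R (P : Type u) C, Function.Injective ι

/-- Auxiliary recursion for `n`-th `C`-syzygies. -/
def IsNthCSyzygyAux (C : Type u) [AddCommGroup C] [Module R C] :
    ℕ → ModuleCat.{u} R → Prop
  | 0, _ => True
  | (m+1), M =>
    ∃ P : ModuleCat.{u} R, Module.Projective R P ∧
      ∃ ι : (M : Type u) →ₗ[R] TensorProduct R (P : Type u) C, Function.Injective ι ∧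
        IsNthCSyzygyAux C m
          (ModuleCat.of R (TensorProduct R (P : Type u) C ⧸ LinearMap.range ι))

/-- `M` is an `n`-th `C`-syzygy: there is an exact sequence
`0 → M → C₁ → ⋯ → C_n` with each `C_j` of the form `P_j ⊗_R C`, `P_j` projective. -/
def IsNthCSyzygy (n : ℕ) (C M : Type u) [AddCommGroup C] [Module R C]
    [AddCommGroup M] [Module R M] : Prop :=
  IsNthCSyzygyAux R C n (ModuleCat.of R M)

/-- The biduality map `M → Hom_R(Hom_R(M,C),C)`. -/
def bidualityMap (C M : Type u) [AddCommGroup C] [Module R C]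
    [AddCommGroup M] [Module R M] : M →ₗ[R] ((M →ₗ[R] C) →ₗ[R] C) :=
  (LinearMap.id : (M →ₗ[R] C) →ₗ[R] (M →ₗ[R] C)).flip

/-- `M` has `G_C`-dimension zero. -/
def GCdimZero (C M : Type u) [AddCommGroup C] [Module R C]
    [AddCommGroup M] [Module R M] : Prop :=
  Module.Finite R M ∧
  Function.Bijective (bidualityMap R C M) ∧
  (∀ i : ℕ, 0 < i → Subsingleton (ExtGrp R M C i)) ∧
  (∀ i : ℕ, 0 < i → Subsingleton (ExtGrp R (M →ₗ[R] C) C i))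

/-- `G_C`-dim`_R(M) ≤ n`: there is a resolution of `M` of length `≤ n` by modules of
`G_C`-dimension zero. -/
def GCdimLE (C M : Type u) [AddCommGroup C] [Module R C]
    [AddCommGroup M] [Module R M] (n : ℕ) : Prop :=
  ∃ (G : ℕ → ModuleCat.{u} R) (d : ∀ i : ℕ, (G (i+1) : Type u) →ₗ[R] G i)
    (ε : (G 0 : Type u) →ₗ[R] M),
    Function.Surjective ε ∧
    LinearMap.range (d 0) = LinearMap.ker ε ∧
    (∀ i : ℕ, LinearMap.range (d (i+1)) = LinearMap.ker (d i)) ∧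
    (∀ i : ℕ, GCdimZero R C (G i)) ∧
    (∀ i : ℕ, n < i → Subsingleton (G i))

/-- `G_C`-dim`_R(M) < ∞`. -/
def GCdimFinite (C M : Type u) [AddCommGroup C] [Module R C]
    [AddCommGroup M] [Module R M] : Prop :=
  ∃ n : ℕ, GCdimLE R C M n

/-- The "depth of `I` on `M`" (classical grade): `inf{ i | Ext^i_R(R/I, M) ≠ 0 }`,
as an extended natural number. -/
def edepth (I : Ideal R) (M : Type u) [AddCommGroup M] [Module R M] : ℕ∞ :=
  sInf {n : ℕ∞ | ∃ i : ℕ, n = i ∧ Nontrivial (ExtGrp R (R ⧸ I) M i)}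

/-- The depth of a module over a local ring. -/
def ldepth [IsLocalRing R] (M : Type u) [AddCommGroup M] [Module R M] : ℕ∞ :=
  edepth R (IsLocalRing.maximalIdeal R) M

/-- `depth_{R_p}(M_p)`. -/
def depthAt (p : Ideal R) [p.IsPrime] (M : Type u) [AddCommGroup M] [Module R M] : ℕ∞ :=
  ldepth (Localization.AtPrime p) (LocalizedModule p.primeCompl M)

/-- `depth R_p`. -/
def ringDepthAt (p : Ideal R) [p.IsPrime] : ℕ∞ :=
  ldepth (Localization.AtPrime p) (Localization.AtPrime p)

/-- Serre's condition `(S̃_n)`: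
`depth_{R_p}(M_p) ≥ min{n, depth R_p}` for all primes `p`. -/
def SerreTilde (n : ℕ) (M : Type u) [AddCommGroup M] [Module R M] : Prop :=
  ∀ (p : Ideal R) (_ : p.IsPrime), min (n : ℕ∞) (ringDepthAt R p) ≤ depthAt R p M

/-- Serre's condition `(S_n)`:
`depth_{R_p}(M_p) ≥ min{n, dim R_p}` for all primes `p`. -/
def SerreS (n : ℕ) (M : Type u) [AddCommGroup M] [Module R M] : Prop :=
  ∀ (p : Ideal R) (_ : p.IsPrime),
    min (n : WithBot ℕ∞) (ringKrullDim (Localization.AtPrime p)) ≤ (depthAt R p M : WithBot ℕ∞)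

/-- The dimension of a module: `dim_R(M) = dim (R / ann_R M)`. -/
def moduleDim (M : Type u) [AddCommGroup M] [Module R M] : WithBot ℕ∞ :=
  ringKrullDim (R ⧸ Module.annihilator R M)

/-- A Cohen-Macaulay module over a local ring: `depth_R(M) = dim_R(M)`. -/
def IsCMModule [IsLocalRing R] (M : Type u) [AddCommGroup M] [Module R M] : Prop :=
  (ldepth R M : WithBot ℕ∞) = moduleDim R M

/-- A maximal Cohen-Macaulay module over a local ring: `depth_R(M) = dim R`. -/
def IsMaximalCM [IsLocalRing R] (M : Type u) [AddCommGroup M] [Module R M] : Prop :=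
  (ldepth R M : WithBot ℕ∞) = ringKrullDim R

/-- A Cohen-Macaulay local ring. -/
def IsCMLocalRing : Prop :=
  ∃ _ : IsLocalRing R, (ldepth R R : WithBot ℕ∞) = ringKrullDim R

/-- `C` has finite injective dimension: for some `n`, `Ext^i_R(-,C)` vanishes
for all `i > n`. -/
def HasFiniteInjDim (C : Type u) [AddCommGroup C] [Module R C] : Prop :=
  ∃ n : ℕ, ∀ (M : ModuleCat.{u} R) (i : ℕ), n < i →
    Subsingleton (((Ext R (ModuleCat.{u} R) i).obj (Opposite.op M)).obj (ModuleCat.of R C))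

/-- `ω` is a canonical module of `R`: a semidualizing module of finite injective
dimension. -/
def IsCanonicalModule (ω : Type u) [AddCommGroup ω] [Module R ω] : Prop :=
  IsSemidualizing R ω ∧ HasFiniteInjDim R ω

/-- `Gid_R(M) ≤ n`: there is an exact complex `⋯ → I_1 → I_0 → I_{-1} → ⋯` of
injective modules, which stays exact under `Hom_R(E,-)` for every injective `E`,
with `M ≅ ker(I_0 → I_{-1})` and `I_j = 0` for `j < -n`. -/
def GidLE (M : Type u) [AddCommGroup M] [Module R M] (n : ℕ) : Prop :=
  ∃ (I : ℤ → ModuleCat.{u} R) (d : ∀ i : ℤ, (I (i+1) : Type u) →ₗ[R] I i),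
    (∀ i : ℤ, Module.Injective R (I i)) ∧
    (∀ i : ℤ, LinearMap.range (d (i+1)) = LinearMap.ker (d i)) ∧
    (∀ E : ModuleCat.{u} R, Module.Injective R E →
      ∀ (i : ℤ) (φ : (E : Type u) →ₗ[R] I (i+1)), d i ∘ₗ φ = 0 →
        ∃ ψ : (E : Type u) →ₗ[R] I (i+1+1), d (i+1) ∘ₗ ψ = φ) ∧
    Nonempty (M ≃ₗ[R] ↥(LinearMap.ker (d (-1)))) ∧
    (∀ i : ℤ, i < -(n : ℤ) → Subsingleton (I i))

/-- `M` has finite Gorenstein injective dimension. -/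
def HasFiniteGid (M : Type u) [AddCommGroup M] [Module R M] : Prop :=
  ∃ n : ℕ, GidLE R M n

/-- The evaluation map `C ⊗_R Hom_R(C,M) → M`. -/
def evalMap (C M : Type u) [AddCommGroup C] [Module R C]
    [AddCommGroup M] [Module R M] : TensorProduct R C (C →ₗ[R] M) →ₗ[R] M :=
  TensorProduct.lift ((LinearMap.id : (C →ₗ[R] M) →ₗ[R] (C →ₗ[R] M)).flip)

/-- Membership in the Bass class `B_C`. -/
def MemBass (C M : Type u) [AddCommGroup C] [Module R C]
    [AddCommGroup M] [Module R M] : Prop :=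
  Function.Bijective (evalMap R C M) ∧
  (∀ i : ℕ, 0 < i → Subsingleton (TorGrp R (C →ₗ[R] M) C i)) ∧
  (∀ i : ℕ, 0 < i → Subsingleton (ExtGrp R C M i))

/-- Membership in the Auslander class `A_C`. -/
def MemAus (C M : Type u) [AddCommGroup C] [Module R C]
    [AddCommGroup M] [Module R M] : Prop :=
  Function.Bijective (TensorProduct.mk R M C) ∧
  (∀ i : ℕ, 0 < i → Subsingleton (TorGrp R M C i)) ∧
  (∀ i : ℕ, 0 < i → Subsingleton (ExtGrp R C (TensorProduct R M C) i))

/-- The grade of a module: the common length of maximal `R`-regular sequences in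
`ann_R(M)`, i.e. `inf{ i | Ext^i(R/ann M, R) ≠ 0 }`. -/
def gradeMod (M : Type u) [AddCommGroup M] [Module R M] : ℕ∞ :=
  edepth R (Module.annihilator R M) R

/-- The grade of an ideal `I`, i.e. `grade_R(R/I)`. -/
def gradeIdeal (I : Ideal R) : ℕ∞ :=
  edepth R I R

/-- An unmixed ideal: every associated prime of `R/I` is a minimal prime of `I`. -/
def IsUnmixedIdeal (I : Ideal R) : Prop :=
  ∀ p ∈ associatedPrimes R (R ⧸ I), p ∈ I.minimalPrimes

/-- Equality of the `a`-th Bass number of `R` (over `R`, w.r.t. the maximal ideal `m`)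
and the `b`-th Bass number of `A` (over `A`, w.r.t. the maximal ideal `mA`): both Ext
modules are vector spaces over the corresponding residue fields of one and the same
dimension. -/
def BassNumbersEq (m : Ideal R) (a : ℕ) (A : Type u) [CommRing A] (mA : Ideal A) (b : ℕ) : Prop :=
  ∃ ι : Type u,
    Nonempty (ExtGrp R (R ⧸ m) R a ≃ₗ[R] (ι →₀ (R ⧸ m))) ∧
    Nonempty (ExtGrp A (A ⧸ mA) A b ≃ₗ[A] (ι →₀ (A ⧸ mA)))

/-- A quasi-Gorenstein ideal of a local ring `R`: `G-dim_R(R/a) < ∞` and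
`μ^{i+depth R}_R(R) = μ^{i+depth R/a}_{R/a}(R/a)` for all `i ≥ 0`. -/
def IsQuasiGorensteinIdeal [IsLocalRing R] (a : Ideal R) : Prop :=
  GCdimFinite R R (R ⧸ a) ∧
  ∀ i : ℕ,
    BassNumbersEq R (IsLocalRing.maximalIdeal R) (i + (ldepth R R).toNat)
      (R ⧸ a) (Ideal.map (Ideal.Quotient.mk a) (IsLocalRing.maximalIdeal R))
      (i + (edepth (R ⧸ a) (Ideal.map (Ideal.Quotient.mk a) (IsLocalRing.maximalIdeal R))
        (R ⧸ a)).toNat)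

/-- `E` is an injective hull of `K`: `E` is injective and contains a copy of `K`
as an essential submodule. -/
def IsInjectiveHull (K E : Type u) [AddCommGroup K] [Module R K]
    [AddCommGroup E] [Module R E] : Prop :=
  Module.Injective R E ∧
  ∃ ι : K →ₗ[R] E, Function.Injective ι ∧
    ∀ N : Submodule R E, N ≠ ⊥ → N ⊓ LinearMap.range ι ≠ ⊥

/-- A generalized Cohen-Macaulay module over a local ring: `dim M ≥ 1` and
`H^i_m(M)` has finite length for all `i < dim M`. -/
def IsGeneralizedCM [IsLocalRing R] (M : Type u) [AddCommGroup M] [Module R M] : Prop :=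
  1 ≤ moduleDim R M ∧
  ∀ i : ℕ, (i : WithBot ℕ∞) < moduleDim R M →
    IsFiniteLength R (LocCoh R (IsLocalRing.maximalIdeal R) i M)

end Paper

namespace Paper

/-- Vanishing of `Ext^i_R(M, N)`, phrased with Mathlib's `CategoryTheory.Abelian.Ext`. -/
def EV (R : Type u) [CommRing R] (M N : Type u) [AddCommGroup M] [Module R M]
    [AddCommGroup N] [Module R N] (i : ℕ) : Prop :=
  Subsingleton (Abelian.Ext.{u} (ModuleCat.of R M) (ModuleCat.of R N) i)

section
variable {R : Type u} [CommRing R]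

lemma subsingleton_homology_linearYonedaObj_iff (K : ChainComplex (ModuleCat.{u} R) ℕ)
    (Y : ModuleCat.{u} R) (n : ℕ) :
    Subsingleton ((K.linearYonedaObj R Y).homology n) ↔
      ∀ f : K.X n ⟶ Y, K.d (n + 1) n ≫ f = 0 →
        ∃ g : K.X ((ComplexShape.up ℕ).prev n) ⟶ Y, K.d n ((ComplexShape.up ℕ).prev n) ≫ g = f := by
  rw [← ModuleCat.isZero_iff_subsingleton, ← HomologicalComplex.exactAt_iff_isZero_homology,
    HomologicalComplex.exactAt_iff' _ _ n (n + 1) rfl (by simp), ShortComplex.moduleCat_exact_iff]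
  rfl

variable {M N : Type u} [AddCommGroup M] [Module R M] [AddCommGroup N] [Module R N]

lemma ev_zero_iff : EV R M N 0 ↔ Subsingleton (M →ₗ[R] N) :=
  (Abelian.Ext.addEquiv₀.toEquiv.trans
    (ModuleCat.homEquiv (M := ModuleCat.of R M) (N := ModuleCat.of R N))).subsingleton_congr

theorem ev_iff_extGrp (i : ℕ) : EV R M N i ↔ Subsingleton (ExtGrp R M N i) := by
  let P := projectiveResolution (ModuleCat.of R M)
  have e := (P.isoExt (R := R) i (ModuleCat.of R N)).toLinearEquiv.toEquiv.subsingleton_congr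
  refine Iff.trans ?_ e.symm
  rw [subsingleton_homology_linearYonedaObj_iff]
  cases i with
  | zero =>
    rw [ev_zero_iff]
    have hdz : P.complex.d 0 ((ComplexShape.up ℕ).prev 0) = 0 :=
      P.complex.shape _ _ (by simp)
    let e := HomologicalComplex.singleObjXSelf (ComplexShape.down ℕ) 0 (ModuleCat.of R M)
    constructor
    · intro h f hf
      refine ⟨0, ?_⟩
      obtain ⟨δ, hδ⟩ : ∃ δ : ((ChainComplex.single₀ (ModuleCat.{u} R)).obj (ModuleCat.of R M)).X 0 ⟶
          ModuleCat.of R N, P.π.f 0 ≫ δ = f :=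
        ⟨P.isColimitCokernelCofork.desc (Limits.CokernelCofork.ofπ f hf),
          P.isColimitCokernelCofork.fac _ Limits.WalkingParallelPair.one⟩
      have h1 : e.inv ≫ δ = 0 :=
        ModuleCat.hom_ext (Subsingleton.elim (α := M →ₗ[R] N) _ _)
      have h2 : δ = 0 := by
        rw [← cancel_epi e.inv, h1, Limits.comp_zero]
      rw [← hδ, h2, Limits.comp_zero, Limits.comp_zero]
    · intro h
      have key : ∀ φ : M →ₗ[R] N, φ = 0 := by
        intro φ
        obtain ⟨g, hg⟩ := h (P.π.f 0 ≫ e.hom ≫ ModuleCat.ofHom φ) (by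
          rw [← Category.assoc, P.complex_d_comp_π_f_zero, Limits.zero_comp])
        rw [hdz, Limits.zero_comp] at hg
        have h3 : ModuleCat.ofHom φ = 0 := by
          rw [← cancel_epi e.hom, ← cancel_epi (P.π.f 0), ← hg, Limits.comp_zero, Limits.comp_zero]
        exact congrArg ModuleCat.Hom.hom h3
      exact ⟨fun a b => by rw [key a, key b]⟩
  | succ k =>
    have hp : (ComplexShape.up ℕ).prev (k + 1) = k := by simp
    rw [hp]
    constructor
    · intro h f hf
      exact (P.extMk_eq_zero_iff f (k + 2) rfl hf k rfl).1 (h.elim _ _)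
    · intro h
      refine ⟨fun a b => ?_⟩
      have key : ∀ a : Abelian.Ext (ModuleCat.of R M) (ModuleCat.of R N) (k + 1), a = 0 := by
        intro a
        obtain ⟨f, hf, rfl⟩ := P.extMk_surjective a (k + 2) rfl
        exact (P.extMk_eq_zero_iff f (k + 2) rfl hf k rfl).2 (h f hf)
      rw [key a, key b]

end

section
variable {R : Type u} [CommRing R]
variable {A B D X Y : Type u} [AddCommGroup A] [Module R A] [AddCommGroup B] [Module R B]
  [AddCommGroup D] [Module R D] [AddCommGroup X] [Module R X] [AddCommGroup Y] [Module R Y]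

lemma ev_of_forall_eq_zero {i : ℕ}
    (h : ∀ x : Abelian.Ext (ModuleCat.of R X) (ModuleCat.of R Y) i, x = 0) : EV R X Y i :=
  ⟨fun a b => by rw [h a, h b]⟩

lemma EV.eq_zero {i : ℕ} (h : EV R X Y i)
    (x : Abelian.Ext (ModuleCat.of R X) (ModuleCat.of R Y) i) : x = 0 :=
  h.elim _ _

lemma EV.hom_eq_zero (h : EV R X Y 0) (f : X →ₗ[R] Y) : f = 0 :=
  (ev_zero_iff.1 h).elim _ _

/-- The short exact sequence in `ModuleCat` attached to an exact pair of linear maps. -/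
lemma shortExact_of_exact {f : A →ₗ[R] B} {g : B →ₗ[R] D} (hf : Function.Injective f)
    (hg : Function.Surjective g) (h : Function.Exact f g) :
    (ModuleCat.shortComplexOfCompEqZero f g h.linearMap_comp_eq_zero).ShortExact :=
  ModuleCat.shortComplex_shortExact _ h hf hg

section
variable {f : A →ₗ[R] B} {g : B →ₗ[R] D} (hf : Function.Injective f)
    (hg : Function.Surjective g) (h : Function.Exact f g)
include hf hg h

lemma ev_cov₁ {i : ℕ} (hB : EV R X B (i + 1)) (hD : EV R X D i) : EV R X A (i + 1) := by
  refine ev_of_forall_eq_zero fun x => ?_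
  obtain ⟨y, rfl⟩ := Abelian.Ext.covariant_sequence_exact₁ _ (shortExact_of_exact hf hg h) x
    (hB.eq_zero _) rfl
  rw [hD.eq_zero y, Abelian.Ext.zero_comp]

lemma ev_cov₃ {i : ℕ} (hB : EV R X B i) (hA : EV R X A (i + 1)) : EV R X D i := by
  refine ev_of_forall_eq_zero fun x => ?_
  obtain ⟨y, rfl⟩ := Abelian.Ext.covariant_sequence_exact₃ _ (shortExact_of_exact hf hg h) x rfl
    (hA.eq_zero _)
  rw [hB.eq_zero y, Abelian.Ext.zero_comp]

lemma ev_con₂ {i : ℕ} (hA : EV R A Y i) (hD : EV R D Y i) : EV R B Y i := by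
  refine ev_of_forall_eq_zero fun x => ?_
  obtain ⟨y, rfl⟩ := Abelian.Ext.contravariant_sequence_exact₂ (shortExact_of_exact hf hg h) _ x
    (hA.eq_zero _)
  rw [hD.eq_zero y, Abelian.Ext.comp_zero]

lemma ev_con₁ {i : ℕ} (hB : EV R B Y i) (hD : EV R D Y (i + 1)) : EV R A Y i := by
  refine ev_of_forall_eq_zero fun x => ?_
  obtain ⟨y, rfl⟩ := Abelian.Ext.contravariant_sequence_exact₁ (shortExact_of_exact hf hg h) _ x
    (Nat.add_comm 1 i) (hD.eq_zero _)
  rw [hB.eq_zero y, Abelian.Ext.comp_zero]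

lemma ev_con₃ {i : ℕ} (hB : EV R B Y (i + 1)) (hA : EV R A Y i) : EV R D Y (i + 1) := by
  refine ev_of_forall_eq_zero fun x => ?_
  obtain ⟨y, rfl⟩ := Abelian.Ext.contravariant_sequence_exact₃ (shortExact_of_exact hf hg h) _ x
    (hB.eq_zero _) (Nat.add_comm 1 i)
  rw [hA.eq_zero y, Abelian.Ext.comp_zero]

lemma ev_one_extend (hD : EV R D Y 1) (φ : A →ₗ[R] Y) : ∃ ψ : B →ₗ[R] Y, ψ ∘ₗ f = φ := by
  obtain ⟨y, hy⟩ := Abelian.Ext.contravariant_sequence_exact₁ (shortExact_of_exact hf hg h)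
    (ModuleCat.of R Y) (Abelian.Ext.mk₀ (ModuleCat.ofHom φ)) rfl (hD.eq_zero _)
  obtain ⟨ψ, rfl⟩ := Abelian.Ext.addEquiv₀.symm.surjective y
  refine ⟨ψ.hom, ?_⟩
  change (Abelian.Ext.mk₀ _).comp (Abelian.Ext.mk₀ _) _ = _ at hy
  rw [Abelian.Ext.mk₀_comp_mk₀] at hy
  exact congrArg ModuleCat.Hom.hom (Abelian.Ext.addEquiv₀.symm.injective hy)

lemma ev_one_of_extend (hB : EV R B Y 1)
    (H : ∀ φ : A →ₗ[R] Y, ∃ ψ : B →ₗ[R] Y, ψ ∘ₗ f = φ) : EV R D Y 1 := by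
  refine ev_of_forall_eq_zero fun x => ?_
  have hS := shortExact_of_exact hf hg h
  obtain ⟨y, rfl⟩ := Abelian.Ext.contravariant_sequence_exact₃ hS _ x
    (hB.eq_zero _) (Nat.add_comm 1 0)
  obtain ⟨φ, rfl⟩ := Abelian.Ext.addEquiv₀.symm.surjective y
  obtain ⟨ψ, hψ⟩ := H φ.hom
  have e : φ = ModuleCat.ofHom f ≫ ModuleCat.ofHom ψ := ModuleCat.hom_ext hψ.symm
  change hS.extClass.comp (Abelian.Ext.mk₀ φ) _ = 0
  rw [e, ← Abelian.Ext.mk₀_comp_mk₀, ← Abelian.Ext.comp_assoc (α := hS.extClass) (h₁₂ := add_zero 1)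
    (h₂₃ := add_zero 0) (h := by simp)]
  have := hS.extClass_comp
  exact (congrArg
    (fun z => Abelian.Ext.comp z (Abelian.Ext.mk₀ (ModuleCat.ofHom ψ)) (add_zero 1)) this).trans
    (Abelian.Ext.zero_comp _ _ _ _ _)

end

lemma ev_projective [Module.Projective R X] (i : ℕ) : EV R X Y (i + 1) :=
  have : Projective (ModuleCat.of R X) := (IsProjective.iff_projective X).1 inferInstance
  ev_of_forall_eq_zero fun x => Abelian.Ext.eq_zero_of_projective x

lemma EV.retract_left {i : ℕ} (h : EV R B Y i) (f : A →ₗ[R] B) (g : B →ₗ[R] A)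
    (hgf : g ∘ₗ f = LinearMap.id) : EV R A Y i := by
  refine ev_of_forall_eq_zero fun x => ?_
  have e : ModuleCat.ofHom f ≫ ModuleCat.ofHom g = 𝟙 (ModuleCat.of R A) :=
    ModuleCat.hom_ext hgf
  rw [← Abelian.Ext.mk₀_id_comp x, ← e, ← Abelian.Ext.mk₀_comp_mk₀_assoc,
    h.eq_zero ((Abelian.Ext.mk₀ (ModuleCat.ofHom g)).comp x (zero_add i)), Abelian.Ext.comp_zero]

lemma EV.retract_right {i : ℕ} (h : EV R X B i) (f : A →ₗ[R] B) (g : B →ₗ[R] A)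
    (hgf : g ∘ₗ f = LinearMap.id) : EV R X A i := by
  refine ev_of_forall_eq_zero fun x => ?_
  have e : ModuleCat.ofHom f ≫ ModuleCat.ofHom g = 𝟙 (ModuleCat.of R A) :=
    ModuleCat.hom_ext hgf
  have := Abelian.Ext.comp_mk₀_id x
  rw [← this, ← e, ← Abelian.Ext.mk₀_comp_mk₀,
   ← Abelian.Ext.comp_assoc (α := x) (h₁₂ := add_zero i)
    (h₂₃ := add_zero 0) (h := by simp), h.eq_zero (x.comp _ _), Abelian.Ext.zero_comp]

lemma EV.congr_left {i : ℕ} (h : EV R B Y i) (e : A ≃ₗ[R] B) : EV R A Y i :=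
  h.retract_left e.toLinearMap e.symm.toLinearMap (by ext; simp)

lemma EV.congr_right {i : ℕ} (h : EV R X B i) (e : A ≃ₗ[R] B) : EV R X A i :=
  h.retract_right e.toLinearMap e.symm.toLinearMap (by ext; simp)

lemma ev_subsingleton_left [Subsingleton X] (i : ℕ) : EV R X Y i := by
  cases i with
  | zero => exact ev_zero_iff.2 inferInstance
  | succ k =>
    have : Module.Projective R X := Module.Projective.of_equiv (0 : PUnit.{u+1} ≃ₗ[R] X)
    exact ev_projective k

lemma ev_subsingleton_right [Subsingleton Y] (i : ℕ) : EV R X Y i := by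
  cases i with
  | zero => exact ev_zero_iff.2 inferInstance
  | succ k =>
    refine ev_of_forall_eq_zero fun x => ?_
    have e : 𝟙 (ModuleCat.of R Y) = 0 := ModuleCat.hom_ext (Subsingleton.elim (α := Y →ₗ[R] Y) _ _)
    have := Abelian.Ext.comp_mk₀_id x
    rw [← this, e, Abelian.Ext.mk₀_zero, Abelian.Ext.comp_zero]

lemma ofHom_lsmul (x : R) : ModuleCat.ofHom (LinearMap.lsmul R Y x) = x • 𝟙 (ModuleCat.of R Y) :=
  ModuleCat.hom_ext rfl

/-- If `x` is regular on `Y` and annihilates `X`, then vanishing of `Ext^i(X, Y/xY)`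
gives vanishing of `Ext^{i+1}(X, Y)`. -/
lemma ev_succ_of_smul {i : ℕ} {g : Y →ₗ[R] D} {x : R} (hx : IsSMulRegular Y x)
    (hg : Function.Surjective g) (hk : Function.Exact (LinearMap.lsmul R Y x) g)
    (hX : x ∈ Module.annihilator R X) (h : EV R X D i) : EV R X Y (i + 1) := by
  refine ev_of_forall_eq_zero fun z => ?_
  have hS := shortExact_of_exact (f := LinearMap.lsmul R Y x) hx hg hk
  have hz : z.comp (Abelian.Ext.mk₀ (ModuleCat.ofHom (LinearMap.lsmul R Y x)))
      (add_zero _) = 0 := by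
    have e : x • 𝟙 (ModuleCat.of R X) = 0 := ModuleCat.hom_ext
      (LinearMap.ext fun a => Module.mem_annihilator.1 hX a)
    rw [ofHom_lsmul, Abelian.Ext.mk₀_smul, Abelian.Ext.comp_smul]
    have h1 := Abelian.Ext.comp_mk₀_id z
    have h2 := Abelian.Ext.mk₀_id_comp z
    rw [h1]
    rw [← h2, ← Abelian.Ext.smul_comp, ← Abelian.Ext.mk₀_smul, e, Abelian.Ext.mk₀_zero,
      Abelian.Ext.zero_comp]
  obtain ⟨y, rfl⟩ := Abelian.Ext.covariant_sequence_exact₁ _ hS z hz rfl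
  rw [h.eq_zero y, Abelian.Ext.zero_comp]

/-- If `x` is regular on `X`, then vanishing of `Ext^{i+1}(X/xX, Y)`
makes multiplication by `x` surjective on `Ext^i(X, Y)`. -/
lemma ev_of_smul {i : ℕ} [IsNoetherianRing R] [IsLocalRing R] [Module.Finite R X]
    [Module.Finite R Y]
    {g : X →ₗ[R] D} {x : R} (hx : IsSMulRegular X x)
    (hg : Function.Surjective g) (hk : Function.Exact (LinearMap.lsmul R X x) g)
    (hxm : x ∈ IsLocalRing.maximalIdeal R) (h : EV R D Y (i + 1)) : EV R X Y i := by
  have hS := shortExact_of_exact (f := LinearMap.lsmul R X x) hx hg hk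
  have hsurj : ∀ z : Abelian.Ext.{u} (ModuleCat.of R X) (ModuleCat.of R Y) i, ∃ w, x • w = z := by
    intro z
    obtain ⟨w, hw⟩ := Abelian.Ext.contravariant_sequence_exact₁ hS _ z (Nat.add_comm 1 i)
      (h.eq_zero _)
    refine ⟨w, ?_⟩
    rw [← hw]
    have h1 := Abelian.Ext.mk₀_id_comp w
    change _ = (Abelian.Ext.mk₀ (ModuleCat.ofHom (LinearMap.lsmul R X x))).comp w (zero_add i)
    rw [ofHom_lsmul, Abelian.Ext.mk₀_smul, Abelian.Ext.smul_comp, h1]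
  have htop : (⊤ : Submodule R (Abelian.Ext.{u} (ModuleCat.of R X) (ModuleCat.of R Y) i)) = ⊥ := by
    refine Submodule.eq_bot_of_le_smul_of_le_jacobson_bot (IsLocalRing.maximalIdeal R) _
      Module.Finite.fg_top ?_ (IsLocalRing.maximalIdeal_le_jacobson _)
    intro z _
    obtain ⟨w, rfl⟩ := hsurj z
    exact Submodule.smul_mem_smul hxm trivial
  exact ev_of_forall_eq_zero fun z => (Submodule.mem_bot R).1 (htop ▸ Submodule.mem_top)

end

section
variable {R : Type u} [CommRing R]
variable {A B D X Y : Type u} [AddCommGroup A] [Module R A] [AddCommGroup B] [Module R B]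
  [AddCommGroup D] [Module R D] [AddCommGroup X] [Module R X] [AddCommGroup Y] [Module R Y]

lemma exact_ker_subtype (g : A →ₗ[R] B) : Function.Exact (LinearMap.ker g).subtype g :=
  fun x => ⟨fun h => ⟨⟨x, h⟩, rfl⟩, by rintro ⟨y, rfl⟩; exact y.2⟩

variable (R) in
lemma exists_free_cover (L : Type u) [AddCommGroup L] [Module R L] [Module.Finite R L] :
    ∃ (k : ℕ) (g : (Fin k → R) →ₗ[R] L), Function.Surjective g :=
  Module.Finite.exists_fin' R L

lemma ev_finsupp [IsNoetherianRing R] {L N : Type u} [AddCommGroup L] [Module R L]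
    [AddCommGroup N] [Module R N] [Module.Finite R L] (ι : Type u) {i : ℕ} (h : EV R L N i) :
    EV R L (ι →₀ N) i := by
  match i with
  | 0 =>
    refine ev_zero_iff.2 ⟨fun f g => ?_⟩
    ext x j
    have h1 := h.hom_eq_zero (Finsupp.lapply j ∘ₗ f)
    have h2 := h.hom_eq_zero (Finsupp.lapply j ∘ₗ g)
    exact (LinearMap.congr_fun h1 x).trans (LinearMap.congr_fun h2 x).symm
  | 1 =>
    obtain ⟨k, g, hg⟩ := exists_free_cover R L
    refine ev_one_of_extend (Submodule.injective_subtype _) hg (exact_ker_subtype g)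
      (ev_projective 0) fun φ => ?_
    have H (j : ι) : ∃ ψ : (Fin k → R) →ₗ[R] N,
        ψ ∘ₗ (LinearMap.ker g).subtype = Finsupp.lapply j ∘ₗ φ :=
      ev_one_extend (Submodule.injective_subtype _) hg (exact_ker_subtype g) h _
    choose ψ hψ using H
    obtain ⟨s, hs⟩ : ∃ s : Finset ι, ∀ x, ∀ j, j ∉ s → φ x j = 0 := by
      classical
      obtain ⟨t, ht⟩ := (Module.Finite.fg_top : (⊤ : Submodule R (LinearMap.ker g)).FG)
      refine ⟨t.biUnion fun x => (φ x).support, fun x j hj => ?_⟩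
      have hle : (⊤ : Submodule R (LinearMap.ker g)) ≤ LinearMap.ker (Finsupp.lapply j ∘ₗ φ) := by
        rw [← ht, Submodule.span_le]
        intro y hy
        by_contra hne
        exact hj (Finset.mem_biUnion.2 ⟨y, hy, Finsupp.mem_support_iff.2 hne⟩)
      exact hle (Submodule.mem_top : x ∈ ⊤)
    refine ⟨∑ j ∈ s, Finsupp.lsingle j ∘ₗ ψ j, ?_⟩
    classical
    ext x j
    have := LinearMap.congr_fun (hψ j) x
    simp only [LinearMap.comp_apply, Finsupp.lapply_apply] at this
    simp only [LinearMap.comp_apply, LinearMap.sum_apply, Finsupp.lsingle_apply,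
      Finsupp.finsetSum_apply, Finsupp.single_apply, Finset.sum_ite_eq']
    split_ifs with hj
    · exact this
    · exact (hs x j hj).symm
  | i + 2 =>
    obtain ⟨k, g, hg⟩ := exists_free_cover R L
    have h1 : EV R (LinearMap.ker g) N (i + 1) :=
      ev_con₁ (Submodule.injective_subtype _) hg (exact_ker_subtype g) (ev_projective i) h
    exact ev_con₃ (Submodule.injective_subtype _) hg (exact_ker_subtype g) (ev_projective _)
      (ev_finsupp ι h1)
termination_by i

section Localization
variable (S : Submonoid R)

lemma loc_exact {f : A →ₗ[R] B} {g : B →ₗ[R] D} (h : Function.Exact f g) :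
    Function.Exact (LocalizedModule.map S f) (LocalizedModule.map S g) :=
  LocalizedModule.map_exact S f g h

/-- Localization commutes with `Hom` out of a finitely generated module over a Noetherian ring. -/
def locHom [IsNoetherianRing R] (A B : Type u) [AddCommGroup A] [Module R A]
    [AddCommGroup B] [Module R B] [Module.Finite R A] :
    LocalizedModule S (A →ₗ[R] B) ≃ₗ[Localization S]
      (LocalizedModule S A →ₗ[Localization S] LocalizedModule S B) :=
  have := Module.finitePresentation_of_finite R A
  (Module.FinitePresentation.linearEquivMapExtendScalars S).extendScalarsOfIsLocalization S
    (Localization S)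

/-- Localization commutes with direct sums. -/
def locFinsupp (ι : Type u) (A : Type u) [AddCommGroup A] [Module R A] :
    LocalizedModule S (ι →₀ A) ≃ₗ[Localization S] (ι →₀ LocalizedModule S A) :=
  (IsLocalizedModule.iso S (Finsupp.mapRange.linearMap (α := ι)
    (LocalizedModule.mkLinearMap S A))).extendScalarsOfIsLocalization S (Localization S)

lemma loc_hom_lift [IsNoetherianRing R] [Module.Finite R A]
    (φ : LocalizedModule S A →ₗ[Localization S] LocalizedModule S B) :
    ∃ (s : S) (ψ : A →ₗ[R] B), (s : R) • φ = LocalizedModule.map S ψ := by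
  have := Module.finitePresentation_of_finite R A
  obtain ⟨⟨ψ, s⟩, h⟩ := IsLocalizedModule.surj S (LocalizedModule.map S (M := A) (N := B)) φ
  exact ⟨s, ψ, h⟩

lemma loc_map_comp (f : A →ₗ[R] B) (g : B →ₗ[R] D) :
    LocalizedModule.map S (g ∘ₗ f) = LocalizedModule.map S g ∘ₗ LocalizedModule.map S f := by
  refine LinearMap.ext fun x => ?_
  induction x using LocalizedModule.induction_on with
  | h m s => simp

/-- Localization of a linear equivalence. -/
def locEquiv (e : A ≃ₗ[R] B) : LocalizedModule S A ≃ₗ[Localization S] LocalizedModule S B :=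
  LinearEquiv.ofLinearMap (LocalizedModule.map S e.toLinearMap)
    (LocalizedModule.map S e.symm.toLinearMap)
    (by rw [← loc_map_comp]; simp) (by rw [← loc_map_comp]; simp)

lemma loc_ev [IsNoetherianRing R] {L N : Type u} [AddCommGroup L] [Module R L]
    [AddCommGroup N] [Module R N] [Module.Finite R L] {i : ℕ} (h : EV R L N (i + 1)) :
    EV (Localization S) (LocalizedModule S L) (LocalizedModule S N) (i + 1) := by
  obtain ⟨k, g, hg⟩ := exists_free_cover R L
  have h1 := LocalizedModule.map_injective S _ (Submodule.injective_subtype (LinearMap.ker g))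
  have h2 := LocalizedModule.map_surjective S g hg
  have h3 := loc_exact S (exact_ker_subtype g)
  match i with
  | 0 =>
    refine ev_one_of_extend h1 h2 h3 (ev_projective 0) fun φ => ?_
    obtain ⟨s, φ', hφ⟩ := loc_hom_lift S φ
    obtain ⟨ψ, rfl⟩ := ev_one_extend (Submodule.injective_subtype _) hg (exact_ker_subtype g) h φ'
    refine ⟨Localization.mk 1 s • LocalizedModule.map S ψ, ?_⟩
    rw [LinearMap.smul_comp, ← loc_map_comp, ← hφ, ← algebraMap_smul (Localization S) (s : R),
      smul_smul]
    have : Localization.mk 1 s * algebraMap R (Localization S) s = 1 := by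
      rw [← Localization.mk_one_eq_algebraMap, Localization.mk_mul, one_mul, mul_one]
      exact Localization.mk_self s
    rw [this, one_smul]
  | i + 1 =>
    have h4 : EV R (LinearMap.ker g) N (i + 1) :=
      ev_con₁ (Submodule.injective_subtype _) hg (exact_ker_subtype g) (ev_projective i) h
    exact ev_con₃ h1 h2 h3 (ev_projective _) (loc_ev h4)
termination_by i

end Localization

end

section
variable {R : Type u} [CommRing R]
variable {A B D X Y : Type u} [AddCommGroup A] [Module R A] [AddCommGroup B] [Module R B]
  [AddCommGroup D] [Module R D] [AddCommGroup X] [Module R X] [AddCommGroup Y] [Module R Y]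

lemma ev_one_lift {f : A →ₗ[R] B} {g : B →ₗ[R] D} (hf : Function.Injective f)
    (hg : Function.Surjective g) (h : Function.Exact f g) (hA : EV R X A 1) (φ : X →ₗ[R] D) :
    ∃ ψ : X →ₗ[R] B, g ∘ₗ ψ = φ := by
  obtain ⟨y, hy⟩ := Abelian.Ext.covariant_sequence_exact₃ (ModuleCat.of R X)
    (shortExact_of_exact hf hg h) (Abelian.Ext.mk₀ (ModuleCat.ofHom φ)) rfl (hA.eq_zero _)
  obtain ⟨ψ, rfl⟩ := Abelian.Ext.addEquiv₀.symm.surjective y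
  refine ⟨ψ.hom, ?_⟩
  change (Abelian.Ext.mk₀ _).comp (Abelian.Ext.mk₀ _) _ = _ at hy
  rw [Abelian.Ext.mk₀_comp_mk₀] at hy
  exact congrArg ModuleCat.Hom.hom (Abelian.Ext.addEquiv₀.symm.injective hy)

lemma ev_zero_of_injective {f : A →ₗ[R] B} (hf : Function.Injective f) (h : EV R X B 0) :
    EV R X A 0 :=
  ev_zero_iff.2 ⟨fun a b => LinearMap.ext fun x => hf <| by
    rw [← LinearMap.comp_apply, ← LinearMap.comp_apply, h.hom_eq_zero (f ∘ₗ a),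
      h.hom_eq_zero (f ∘ₗ b)]⟩

lemma ev_zero_of_surjective {g : B →ₗ[R] D} (hg : Function.Surjective g) (h : EV R B Y 0) :
    EV R D Y 0 :=
  ev_zero_iff.2 ⟨fun a b => LinearMap.ext fun x => by
    obtain ⟨z, rfl⟩ := hg x
    rw [← LinearMap.comp_apply, ← LinearMap.comp_apply, h.hom_eq_zero (a ∘ₗ g),
      h.hom_eq_zero (b ∘ₗ g)]⟩

lemma ev_pi [IsNoetherianRing R] [Module.Finite R X] (k : ℕ) {i : ℕ} (h : EV R X Y i) :
    EV R X (Fin k → Y) i :=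
  (ev_finsupp (ULift.{u} (Fin k)) h).congr_right
    ((Finsupp.linearEquivFunOnFinite R Y (Fin k)).symm.trans
      (Finsupp.domLCongr Equiv.ulift.symm))

variable (R) in
/-- `Ext^i(R/m, N) = 0` for all `i < t`; that is, `depth N ≥ t`. -/
def DGE [IsLocalRing R] (N : Type u) [AddCommGroup N] [Module R N] (t : ℕ) : Prop :=
  ∀ i < t, EV R (R ⧸ IsLocalRing.maximalIdeal R) N i

lemma le_edepth_iff (I : Ideal R) (t : ℕ) :
    (t : ℕ∞) ≤ edepth R I X ↔ ∀ i < t, EV R (R ⧸ I) X i := by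
  unfold edepth
  rw [le_sInf_iff]
  constructor
  · intro h i hi
    by_contra hne
    rw [ev_iff_extGrp, not_subsingleton_iff_nontrivial] at hne
    exact absurd (Nat.cast_le.1 (h i ⟨i, rfl, hne⟩)) (by omega)
  · rintro h _ ⟨i, rfl, hi⟩
    by_contra hlt
    have h2 := h i (by exact_mod_cast not_le.1 hlt)
    rw [ev_iff_extGrp] at h2
    exact not_subsingleton_iff_nontrivial.2 hi h2

section Local
variable [IsLocalRing R]

lemma le_ldepth_iff (t : ℕ) : (t : ℕ∞) ≤ ldepth R X ↔ DGE R X t :=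
  le_edepth_iff _ t

lemma DGE.mono {s t : ℕ} (h : DGE R X t) (hst : s ≤ t) : DGE R X s :=
  fun i hi => h i (by omega)

lemma DGE.congr {t : ℕ} (h : DGE R X t) (e : Y ≃ₗ[R] X) : DGE R Y t :=
  fun i hi => (h i hi).congr_right e

lemma dge_zero : DGE R X 0 := fun i hi => absurd hi (by omega)

lemma DGE.of_injective {f : A →ₗ[R] B} (hf : Function.Injective f) (h : DGE R B 1) :
    DGE R A 1 := by
  intro i hi
  obtain rfl : i = 0 := by omega
  exact ev_zero_of_injective hf (h 0 hi)

section
variable {f : A →ₗ[R] B} {g : B →ₗ[R] D} (hf : Function.Injective f)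
    (hg : Function.Surjective g) (h : Function.Exact f g)
include hf hg h

lemma dge_left {t : ℕ} (hB : DGE R B (t + 1)) (hD : DGE R D t) : DGE R A (t + 1) := by
  intro i hi
  cases i with
  | zero => exact ev_zero_of_injective hf (hB 0 hi)
  | succ j => exact ev_cov₁ hf hg h (hB _ hi) (hD j (by omega))

lemma dge_right {t : ℕ} (hB : DGE R B t) (hA : DGE R A (t + 1)) : DGE R D t :=
  fun i hi => ev_cov₃ hf hg h (hB i hi) (hA (i + 1) (by omega))

end

variable [IsNoetherianRing R]

lemma DGE.pi {t : ℕ} (h : DGE R X t) (k : ℕ) : DGE R (Fin k → X) t :=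
  fun i hi => ev_pi k (h i hi)

omit [IsNoetherianRing R] in
lemma mem_annihilator_residue {x : R} :
    x ∈ Module.annihilator R (R ⧸ IsLocalRing.maximalIdeal R) ↔ x ∈ IsLocalRing.maximalIdeal R := by
  rw [Ideal.annihilator_quotient]

lemma DGE.exists_regular [Module.Finite R X] (h : DGE R X 1) :
    ∃ x ∈ IsLocalRing.maximalIdeal R, IsSMulRegular X x := by
  obtain ⟨x, hx, hr⟩ := IsSMulRegular.subsingleton_linearMap_iff.1
    (ev_zero_iff.1 (h 0 (by omega)))
  exact ⟨x, mem_annihilator_residue.1 hx, hr⟩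

omit [IsLocalRing R] [IsNoetherianRing R] in
/-- The canonical exact sequence `X → X → X / xX`. -/
lemma exact_lsmul_mkQ (X : Type u) [AddCommGroup X] [Module R X] (x : R) :
    Function.Exact (LinearMap.lsmul R X x) (LinearMap.range (LinearMap.lsmul R X x)).mkQ :=
  LinearMap.exact_map_mkQ_range _

omit [IsNoetherianRing R] in
lemma DGE.succ_of_quot {x : R} (hx : x ∈ IsLocalRing.maximalIdeal R) (hr : IsSMulRegular X x)
    {t : ℕ} (h0 : DGE R X 1)
    (h : DGE R (X ⧸ LinearMap.range (LinearMap.lsmul R X x)) t) : DGE R X (t + 1) := by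
  intro i hi
  cases i with
  | zero => exact h0 0 (by omega)
  | succ j =>
    exact ev_succ_of_smul hr (Submodule.mkQ_surjective _) (exact_lsmul_mkQ X x)
      (mem_annihilator_residue.2 hx) (h j (by omega))

omit [IsNoetherianRing R] in
lemma DGE.quot {x : R} (hr : IsSMulRegular X x) {t : ℕ} (h : DGE R X (t + 1)) :
    DGE R (X ⧸ LinearMap.range (LinearMap.lsmul R X x)) t :=
  dge_right (f := LinearMap.lsmul R X x) hr (Submodule.mkQ_surjective _) (exact_lsmul_mkQ X x)
    (h.mono (by omega)) h

/-- `Hom(R^k, N) ≅ N^k`. -/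
def homFinEquiv (k : ℕ) (N : Type u) [AddCommGroup N] [Module R N] :
    ((Fin k → R) →ₗ[R] N) ≃ₗ[R] (Fin k → N) :=
  ((Pi.basisFun R (Fin k)).constr R).symm

lemma dge_hom {Z N : Type u} [AddCommGroup Z] [Module R Z] [AddCommGroup N] [Module R N]
    [Module.Finite R Z] {t : ℕ} (hE : ∀ i, 0 < i → i + 1 < t → EV R Z N i) (hN : DGE R N t) :
    DGE R (Z →ₗ[R] N) t := by
  induction t generalizing Z with
  | zero => exact dge_zero
  | succ t ih =>
    obtain ⟨k, g, hg⟩ := exists_free_cover R Z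
    have hF : DGE R ((Fin k → R) →ₗ[R] N) (t + 1) := (hN.pi k).congr (homFinEquiv k N)
    have hinj : Function.Injective (LinearMap.lcomp R N g) := fun a b hab =>
      LinearMap.cancel_right hg |>.1 hab
    let ρ := LinearMap.lcomp R N (LinearMap.ker g).subtype
    have hex : Function.Exact (LinearMap.lcomp R N g) ρ.rangeRestrict := by
      intro φ
      rw [← LinearMap.mem_ker, LinearMap.ker_rangeRestrict, LinearMap.mem_ker]
      have hcoe : Function.Exact (LinearMap.lcomp R N g) ρ :=
        LinearMap.exact_lcomp_of_exact_of_surjective N (exact_ker_subtype g) hg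
      exact hcoe φ
    refine dge_left hinj (LinearMap.surjective_rangeRestrict ρ) hex hF ?_
    match t with
    | 0 => exact dge_zero
    | 1 =>
      exact (ih (Z := LinearMap.ker g) (fun i h1 h2 => absurd h2 (by omega))
        (hN.mono (by omega))).of_injective (Submodule.injective_subtype _)
    | t + 2 =>
      have hs : LinearMap.range ρ = ⊤ := LinearMap.range_eq_top.2 fun φ =>
        ev_one_extend (Submodule.injective_subtype _) hg (exact_ker_subtype g)
          (hE 1 (by omega) (by omega)) φ
      refine (ih (Z := LinearMap.ker g) (fun i h1 h2 => ?_) (hN.mono (by omega))).congr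
        ((LinearEquiv.ofEq _ _ hs).trans Submodule.topEquiv)
      obtain ⟨j, rfl⟩ : ∃ j, i = j + 1 := ⟨i - 1, by omega⟩
      exact ev_con₁ (Submodule.injective_subtype _) hg (exact_ker_subtype g) (ev_projective j)
        (hE _ (by omega) (by omega))

omit [IsNoetherianRing R] in
lemma exists_surjective_residue (L : Type u) [AddCommGroup L] [Module R L] [Module.Finite R L]
    [Nontrivial L] : ∃ q : L →ₗ[R] (R ⧸ IsLocalRing.maximalIdeal R), Function.Surjective q := by
  obtain ⟨W, hW, -⟩ := (eq_top_or_exists_le_coatom (⊥ : Submodule R L)).resolve_left bot_ne_top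
  have hs : IsSimpleModule R (L ⧸ W) := isSimpleModule_iff_isCoatom.2 hW
  obtain ⟨I, hI, ⟨e⟩⟩ := isSimpleModule_iff_quot_maximal.1 hs
  obtain rfl := IsLocalRing.eq_maximalIdeal hI
  exact ⟨e.toLinearMap ∘ₗ W.mkQ, e.surjective.comp (Submodule.mkQ_surjective _)⟩

lemma dge_of_dge_hom {L N : Type u} [AddCommGroup L] [Module R L] [AddCommGroup N] [Module R N]
    [Module.Finite R L] [Nontrivial L] [Module.Finite R N] (hE : ∀ i, EV R L N (i + 1)) {t : ℕ}
    (h : DGE R (L →ₗ[R] N) t) : DGE R N t := by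
  induction t generalizing N with
  | zero => exact dge_zero
  | succ t ih =>
    obtain ⟨q, hq⟩ := exists_surjective_residue (R := R) L
    have h1 : DGE R N 1 := by
      intro i hi
      obtain rfl : i = 0 := by omega
      have key : ∀ f : (R ⧸ IsLocalRing.maximalIdeal R) →ₗ[R] N, f = 0 := by
        intro f
        have hle : IsLocalRing.maximalIdeal R ≤
            LinearMap.ker (LinearMap.toSpanSingleton R (L →ₗ[R] N) (f ∘ₗ q)) := by
          intro r hr
          refine LinearMap.mem_ker.2 (LinearMap.ext fun l => ?_)
          have := Module.mem_annihilator.1 (mem_annihilator_residue.2 hr) (q l)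
          simp [← map_smul, this]
        have h2 := (h 0 (by omega)).hom_eq_zero (Submodule.liftQ _ _ hle)
        have h3 := LinearMap.congr_fun h2 (Submodule.Quotient.mk 1)
        rw [← Submodule.mkQ_apply, ← LinearMap.comp_apply, Submodule.liftQ_mkQ,
          LinearMap.toSpanSingleton_apply, one_smul] at h3
        have h4 : f ∘ₗ q = 0 := h3
        refine LinearMap.ext fun y => ?_
        obtain ⟨l, rfl⟩ := hq y
        exact LinearMap.congr_fun h4 l
      exact ev_zero_iff.2 ⟨fun a b => by rw [key a, key b]⟩
    obtain ⟨x, hx, hr⟩ := h1.exists_regular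
    let N' := N ⧸ LinearMap.range (LinearMap.lsmul R N x)
    have hex := exact_lsmul_mkQ N x
    have hsurj := Submodule.mkQ_surjective (LinearMap.range (LinearMap.lsmul R N x))
    refine DGE.succ_of_quot hx hr h1 (ih (fun i => ?_) ?_)
    · exact ev_cov₃ (f := LinearMap.lsmul R N x) hr hsurj hex (hE i) (hE (i + 1))
    · have hr' : IsSMulRegular (L →ₗ[R] N) x := fun a b hab => LinearMap.ext fun l =>
        hr (LinearMap.congr_fun hab l)
      refine dge_right (f := LinearMap.lsmul R (L →ₗ[R] N) x)
        (g := (LinearMap.range (LinearMap.lsmul R N x)).mkQ.compRight R) hr' (fun φ => ?_)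
        (fun φ => ⟨fun h => ?_, ?_⟩) (h.mono (by omega)) h
      · exact ev_one_lift (f := LinearMap.lsmul R N x) hr hsurj hex (hE 0) φ
      · have hm : ∀ l, ∃ y : N, x • y = φ l := fun l =>
          (hex (φ l)).1 (LinearMap.congr_fun h l)
        have hr2 : Function.Injective (LinearMap.lsmul R N x) := hr
        let e := LinearEquiv.ofInjective _ hr2
        refine ⟨e.symm.toLinearMap ∘ₗ φ.codRestrict _ hm, LinearMap.ext fun l => ?_⟩
        have := congrArg Subtype.val (e.apply_symm_apply ⟨φ l, hm l⟩)
        exact this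
      · rintro ⟨ψ, rfl⟩
        refine LinearMap.ext fun l => ?_
        exact (hex (x • ψ l)).2 ⟨ψ l, rfl⟩

end Local
end

section
variable {R : Type u} [CommRing R]
variable {C A B D X Y : Type u} [AddCommGroup C] [Module R C]
  [AddCommGroup A] [Module R A] [AddCommGroup B] [Module R B]
  [AddCommGroup D] [Module R D] [AddCommGroup X] [Module R X] [AddCommGroup Y] [Module R Y]

variable (R C) in
/-- A semidualizing module, with `Ext`-vanishing phrased through `EV`. -/
structure SD : Prop where
  finite : Module.Finite R C
  homothety : Function.Bijective (LinearMap.lsmul R C)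
  ev (i : ℕ) : EV R C C (i + 1)

lemma lcomp_injective {g : B →ₗ[R] D} (hg : Function.Surjective g) :
    Function.Injective (LinearMap.lcomp R C g) :=
  fun _ _ hab => (LinearMap.cancel_right hg).1 hab

lemma lcomp_exact {f : A →ₗ[R] B} {g : B →ₗ[R] D} (h : Function.Exact f g)
    (hg : Function.Surjective g) :
    Function.Exact (LinearMap.lcomp R C g) (LinearMap.lcomp R C f) :=
  LinearMap.exact_lcomp_of_exact_of_surjective C h hg

lemma bidual_apply (x : X) (φ : X →ₗ[R] C) : bidualityMap R C X x φ = φ x := rfl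

lemma bidual_eq_iff {x y : X} :
    bidualityMap R C X x = bidualityMap R C X y ↔ ∀ φ : X →ₗ[R] C, φ x = φ y :=
  LinearMap.ext_iff

lemma bidual_injective_of_injective {f : X →ₗ[R] Y} (hf : Function.Injective f)
    (h : Function.Injective (bidualityMap R C Y)) : Function.Injective (bidualityMap R C X) :=
  fun _ _ hab => hf (h (bidual_eq_iff.2 fun φ => bidual_eq_iff.1 hab (φ ∘ₗ f)))

lemma bidual_bijective_retract {f : X →ₗ[R] Y} {g : Y →ₗ[R] X} (hgf : g ∘ₗ f = LinearMap.id)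
    (h : Function.Bijective (bidualityMap R C Y)) : Function.Bijective (bidualityMap R C X) := by
  have hgf' (x : X) : g (f x) = x := LinearMap.congr_fun hgf x
  refine ⟨bidual_injective_of_injective (f := f)
    (Function.LeftInverse.injective (g := g) hgf') h.1, fun α => ?_⟩
  obtain ⟨y, hy⟩ := h.2 (α ∘ₗ LinearMap.lcomp R C f)
  refine ⟨g y, LinearMap.ext fun φ => ?_⟩
  have := LinearMap.congr_fun hy (φ ∘ₗ g)
  change φ (g y) = α ((φ ∘ₗ g) ∘ₗ f) at this
  rw [bidual_apply, this, LinearMap.comp_assoc, hgf, LinearMap.comp_id]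

lemma bidual_bijective_pi (k : ℕ) (h : Function.Bijective (bidualityMap R C X)) :
    Function.Bijective (bidualityMap R C (Fin k → X)) := by
  refine ⟨fun x y hxy => funext fun j => h.1 (bidual_eq_iff.2 fun φ =>
    bidual_eq_iff.1 hxy (φ ∘ₗ LinearMap.proj j)), fun α => ?_⟩
  choose x hx using fun j : Fin k => h.2 (α ∘ₗ LinearMap.lcomp R C (LinearMap.proj j))
  refine ⟨x, LinearMap.ext fun φ => ?_⟩
  have hφ : φ = ∑ j, (φ ∘ₗ LinearMap.single R (fun _ => X) j) ∘ₗ LinearMap.proj j := by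
    refine LinearMap.ext fun z => ?_
    rw [LinearMap.sum_apply]
    conv_lhs => rw [← LinearMap.sum_single_apply (fun _ => X) z, map_sum]
    rfl
  conv_rhs => rw [hφ, map_sum]
  have h1 (j : Fin k) : α ((φ ∘ₗ LinearMap.single R (fun _ => X) j) ∘ₗ LinearMap.proj j) =
      (φ ∘ₗ LinearMap.single R (fun _ => X) j) (x j) :=
    (LinearMap.congr_fun (hx j) (φ ∘ₗ LinearMap.single R (fun _ => X) j)).symm
  rw [Finset.sum_congr rfl fun j _ => h1 j, bidual_apply]
  conv_lhs => rw [hφ, LinearMap.sum_apply]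
  rfl

lemma bidual_bijective_ring (h : Function.Bijective (LinearMap.lsmul R C)) :
    Function.Bijective (bidualityMap R C R) := by
  have key (r : R) (φ : R →ₗ[R] C) : φ r = r • φ 1 := by rw [← map_smul, smul_eq_mul, mul_one]
  constructor
  · intro r s hrs
    refine h.1 (LinearMap.ext fun c => ?_)
    simpa using bidual_eq_iff.1 hrs (LinearMap.toSpanSingleton R C c)
  · intro α
    obtain ⟨r, hr⟩ := h.2 (α ∘ₗ (LinearMap.ringLmapEquivSelf R R C).symm.toLinearMap)
    refine ⟨r, LinearMap.ext fun φ => ?_⟩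
    have := LinearMap.congr_fun hr (φ 1)
    rw [bidual_apply, key]
    refine this.trans (congrArg α ?_)
    refine LinearMap.ext_ring ?_
    simp

lemma bidual_bijective_self (h : Function.Bijective (LinearMap.lsmul R C)) :
    Function.Bijective (bidualityMap R C C) := by
  constructor
  · intro c d hcd
    exact bidual_eq_iff.1 hcd LinearMap.id
  · intro α
    refine ⟨α LinearMap.id, LinearMap.ext fun φ => ?_⟩
    obtain ⟨r, rfl⟩ := h.2 φ
    rw [bidual_apply, LinearMap.lsmul_apply, ← map_smul]
    congr 1

lemma bidual_bijective_projective [Module.Finite R X] [Module.Projective R X]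
    (h : Function.Bijective (LinearMap.lsmul R C)) : Function.Bijective (bidualityMap R C X) := by
  obtain ⟨k, g, hg⟩ := exists_free_cover R X
  obtain ⟨s, hs⟩ := Module.projective_lifting_property g LinearMap.id hg
  exact bidual_bijective_retract hs (bidual_bijective_pi k (bidual_bijective_ring h))

section Local
variable [IsLocalRing R] [IsNoetherianRing R]

lemma ev_residue_of_not_ev {L : Type u} [AddCommGroup L] [Module R L] [hL : Module.Finite R L]
    [Module.Finite R C] {r : ℕ}
    (hr : ∀ (L : Type u) [AddCommGroup L] [Module R L] [Module.Finite R L], EV R L C (r + 1))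
    (h : ¬ EV R L C r) : ¬ EV R (R ⧸ IsLocalRing.maximalIdeal R) C r := by
  contrapose! h
  induction hL using IsNoetherianRing.induction_on_isQuotientEquivQuotientPrime R with
  | subsingleton N => exact ev_subsingleton_left r
  | quotient N p e =>
    refine EV.congr_left ?_ e
    by_cases hp : p.1 = IsLocalRing.maximalIdeal R
    · rw [hp]; exact h
    · obtain ⟨x, hx, hxp⟩ := SetLike.exists_of_lt
        (lt_of_le_of_ne (IsLocalRing.le_maximalIdeal p.2.ne_top) hp)
      have hreg : IsSMulRegular (R ⧸ p.1) x := by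
        intro a b hab
        have hab' : Ideal.Quotient.mk p.1 x * a = Ideal.Quotient.mk p.1 x * b := hab
        exact mul_left_cancel₀ (fun h0 => hxp (Ideal.Quotient.eq_zero_iff_mem.1 h0)) hab'
      exact ev_of_smul hreg (Submodule.mkQ_surjective _) (exact_lsmul_mkQ _ x) hx (hr _)
  | exact N₁ N₂ N₃ f g hf hg hfg h1 h3 => exact ev_con₂ hf hg hfg h1 h3

variable (R) in
/-- `depth M ≥ depth R`. -/
def Deep (M : Type u) [AddCommGroup M] [Module R M] : Prop := ∀ t, DGE R R t → DGE R M t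

lemma ev_of_dge [Module.Finite R C] {r : ℕ}
    (hr : ∀ (L : Type u) [AddCommGroup L] [Module R L] [Module.Finite R L] (i : ℕ), r < i →
      EV R L C i)
    (j : ℕ) {L : Type u} [AddCommGroup L] [Module R L] [Module.Finite R L] (h : DGE R L j)
    (i : ℕ) (hi : r < i + j) : EV R L C i := by
  induction j generalizing L i with
  | zero => exact hr L i hi
  | succ j ih =>
    obtain ⟨x, hx, hreg⟩ := (h.mono (s := 1) (by omega)).exists_regular
    exact ev_of_smul hreg (Submodule.mkQ_surjective _) (exact_lsmul_mkQ _ x) hx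
      (ih (DGE.quot hreg h) (i + 1) (by omega))

omit [IsNoetherianRing R] in
lemma not_ev_of_not_dge_one {r : ℕ}
    (hr : ∀ (L : Type u) [AddCommGroup L] [Module R L] [Module.Finite R L], EV R L C (r + 1))
    (hk : ¬ EV R (R ⧸ IsLocalRing.maximalIdeal R) C r)
    {L : Type u} [AddCommGroup L] [Module R L] [Module.Finite R L] (h : ¬ DGE R L 1) :
    ¬ EV R L C r := by
  intro hL
  have : ∃ f : (R ⧸ IsLocalRing.maximalIdeal R) →ₗ[R] L, f ≠ 0 := by
    by_contra! h0
    refine h fun i hi => ?_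
    obtain rfl : i = 0 := by omega
    exact ev_zero_iff.2 ⟨fun a b => by rw [h0 a, h0 b]⟩
  obtain ⟨f, hf⟩ := this
  have hs : IsSimpleModule R (R ⧸ IsLocalRing.maximalIdeal R) :=
    isSimpleModule_iff_quot_maximal.2
      ⟨_, IsLocalRing.maximalIdeal.isMaximal R, ⟨LinearEquiv.refl R _⟩⟩
  have hinj := (LinearMap.injective_or_eq_zero f).resolve_right hf
  exact hk (ev_con₁ hinj (Submodule.mkQ_surjective _) (LinearMap.exact_map_mkQ_range f) hL (hr _))

lemma exists_not_ev_of_not_dge {r : ℕ}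
    (hr : ∀ (L : Type u) [AddCommGroup L] [Module R L] [Module.Finite R L], EV R L C (r + 1))
    (hk : ¬ EV R (R ⧸ IsLocalRing.maximalIdeal R) C r) (d : ℕ)
    {L : Type u} [AddCommGroup L] [Module R L] [Module.Finite R L] (h : ¬ DGE R L (d + 1)) :
    ∃ i, r ≤ i + d ∧ ¬ EV R L C i := by
  induction d generalizing L with
  | zero => exact ⟨r, le_rfl, not_ev_of_not_dge_one hr hk h⟩
  | succ d ih =>
    by_cases h1 : DGE R L 1
    · obtain ⟨x, hx, hreg⟩ := h1.exists_regular
      have hq : ¬ DGE R (L ⧸ LinearMap.range (LinearMap.lsmul R L x)) (d + 1) :=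
        fun hq => h (DGE.succ_of_quot hx hreg h1 hq)
      obtain ⟨i, hi, hne⟩ := ih hq
      cases i with
      | zero =>
        exact ⟨0, by omega, fun h0 => hne (ev_zero_of_surjective (Submodule.mkQ_surjective _) h0)⟩
      | succ i =>
        by_cases h2 : EV R L C (i + 1)
        · exact ⟨i, by omega, fun h0 => hne (ev_con₃ (f := LinearMap.lsmul R L x) hreg
            (Submodule.mkQ_surjective _) (exact_lsmul_mkQ L x) h2 h0)⟩
        · exact ⟨i + 1, by omega, h2⟩
    · exact ⟨r, by omega, not_ev_of_not_dge_one hr hk h1⟩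

lemma Deep.ev [Module.Finite R C] (hid : HasFiniteInjDim R C)
    {L : Type u} [AddCommGroup L] [Module R L] [Module.Finite R L] (h : Deep R L) (i : ℕ) :
    EV R L C (i + 1) := by
  classical
  let P (r : ℕ) : Prop := ∀ (L : Type u) [AddCommGroup L] [Module R L] [Module.Finite R L] (i : ℕ),
    r < i → EV R L C i
  have hP : ∃ r, P r := by
    obtain ⟨r, hr⟩ := hid
    exact ⟨r, fun L _ _ _ i hi => (ev_iff_extGrp i).2 (hr (ModuleCat.of R L) i hi)⟩
  obtain ⟨r, hr, hmin⟩ : ∃ r, P r ∧ ∀ s < r, ¬ P s :=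
    ⟨Nat.find hP, Nat.find_spec hP, fun s hs => Nat.find_min hP hs⟩
  cases r with
  | zero => exact hr L _ (by omega)
  | succ r =>
    have h1 := hmin r (by omega)
    simp only [P, not_forall] at h1
    obtain ⟨L', _, _, _, i', hi', hne⟩ := h1
    obtain rfl : i' = r + 1 := by
      by_contra h2
      exact hne (hr L' i' (by omega))
    have hk := ev_residue_of_not_ev (fun L _ _ _ => hr L _ (by omega)) hne
    have hR : DGE R R (r + 1) := by
      by_contra hR
      obtain ⟨j, hj, hne'⟩ := exists_not_ev_of_not_dge (fun L _ _ _ => hr L _ (by omega)) hk r hR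
      obtain ⟨j, rfl⟩ : ∃ k, j = k + 1 := ⟨j - 1, by omega⟩
      exact hne' (ev_projective j)
    exact ev_of_dge hr (r + 1) (h _ hR) (i + 1) (by omega)

omit [IsNoetherianRing R] in
lemma Deep.congr (h : Deep R X) (e : Y ≃ₗ[R] X) : Deep R Y := fun t ht => (h t ht).congr e

omit [IsNoetherianRing R] in
lemma deep_self : Deep R R := fun _ h => h

lemma Deep.pi (h : Deep R X) (k : ℕ) : Deep R (Fin k → X) := fun t ht => (h t ht).pi k

omit [IsNoetherianRing R] in
lemma Deep.left {f : A →ₗ[R] B} {g : B →ₗ[R] D} (hf : Function.Injective f)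
    (hg : Function.Surjective g) (h : Function.Exact f g) (hB : Deep R B) (hD : Deep R D) :
    Deep R A := by
  intro t ht
  cases t with
  | zero => exact dge_zero
  | succ t => exact dge_left hf hg h (hB _ ht) (hD _ (ht.mono (by omega)))

omit [IsLocalRing R] [IsNoetherianRing R] in
lemma SD.nontrivial [Nontrivial R] (hC : SD R C) : Nontrivial C := by
  by_contra h
  rw [not_nontrivial_iff_subsingleton] at h
  exact one_ne_zero (hC.homothety.1 (Subsingleton.elim (LinearMap.lsmul R C 1) _) : (1 : R) = 0)

lemma SD.dge (hC : SD R C) {t : ℕ} (h : DGE R R t) : DGE R C t :=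
  have := hC.finite
  have := hC.nontrivial
  dge_of_dge_hom hC.ev (h.congr (LinearEquiv.ofBijective _ hC.homothety).symm)

lemma SD.deep (hC : SD R C) : Deep R C := fun _ h => hC.dge h

variable (hC : SD R C) (hid : HasFiniteInjDim R C)
include hC hid

lemma Deep.dual [Module.Finite R X] (h : Deep R X) : Deep R (X →ₗ[R] C) := by
  intro t ht
  have := hC.finite
  refine dge_hom (fun i hi _ => ?_) (hC.dge ht)
  obtain ⟨j, rfl⟩ : ∃ k, i = k + 1 := ⟨i - 1, by omega⟩
  exact h.ev hid j

lemma Deep.bidual_surjective [Module.Finite R X] (h : Deep R X) :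
    Function.Surjective (bidualityMap R C X) := by
  have := hC.finite
  intro α
  obtain ⟨k, g, hg⟩ := exists_free_cover R X
  have hZ : Deep R (LinearMap.ker g) :=
    Deep.left (Submodule.injective_subtype _) hg (exact_ker_subtype g) (deep_self.pi k) h
  have hs : Function.Surjective (LinearMap.lcomp R C (LinearMap.ker g).subtype) := fun φ =>
    ev_one_extend (Submodule.injective_subtype _) hg (exact_ker_subtype g) (h.ev hid 0) φ
  obtain ⟨β, hβ⟩ := ev_one_extend (lcomp_injective (C := C) hg) hs
    (lcomp_exact (exact_ker_subtype g) hg) ((hZ.dual hC hid).ev hid 0) α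
  obtain ⟨e, rfl⟩ := (bidual_bijective_projective hC.homothety).2 β
  exact ⟨g e, by rw [← hβ]; rfl⟩

lemma Deep.bidual_bijective [Module.Finite R X] (h : Deep R X) :
    Function.Bijective (bidualityMap R C X) := by
  have := hC.finite
  refine ⟨?_, h.bidual_surjective hC hid⟩
  rw [← LinearMap.ker_eq_bot, Submodule.eq_bot_iff]
  intro x hx
  obtain ⟨k, g, hg⟩ := exists_free_cover R X
  obtain ⟨e, rfl⟩ := hg x
  have hZ : Deep R (LinearMap.ker g) :=
    Deep.left (Submodule.injective_subtype _) hg (exact_ker_subtype g) (deep_self.pi k) h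
  have hs : Function.Surjective (LinearMap.lcomp R C (LinearMap.ker g).subtype) := fun φ =>
    ev_one_extend (Submodule.injective_subtype _) hg (exact_ker_subtype g) (h.ev hid 0) φ
  obtain ⟨γ, hγ⟩ := (lcomp_exact (C := C) (lcomp_exact (C := C) (exact_ker_subtype g) hg) hs
    (bidualityMap R C _ e)).1 (LinearMap.ext fun φ => LinearMap.congr_fun hx φ)
  obtain ⟨z, rfl⟩ := hZ.bidual_surjective hC hid γ
  have : (z : Fin k → R) = e := (bidual_bijective_projective hC.homothety).1 hγ
  rw [← this]
  exact z.2

lemma Deep.coker [Module.Finite R X] [Module.Finite R Y] (hX : Deep R X) (hY : Deep R Y)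
    (ι : X →ₗ[R] Y) (hι : Function.Surjective (LinearMap.lcomp R C ι)) :
    Function.Injective ι ∧ Deep R (Y ⧸ LinearMap.range ι) := by
  have := hC.finite
  have hXb := hX.bidual_bijective hC hid
  have hYb := hY.bidual_bijective hC hid
  refine ⟨fun x y hxy => hXb.1 (bidual_eq_iff.2 fun φ => ?_), ?_⟩
  · obtain ⟨ψ, rfl⟩ := hι φ
    exact congrArg ψ hxy
  let ρ := LinearMap.lcomp R C ι
  have hK : Deep R (LinearMap.ker ρ) := Deep.left (Submodule.injective_subtype _) hι
    (exact_ker_subtype ρ) (hY.dual hC hid) (hX.dual hC hid)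
  let θ : Y →ₗ[R] (LinearMap.ker ρ →ₗ[R] C) :=
    LinearMap.lcomp R C (LinearMap.ker ρ).subtype ∘ₗ bidualityMap R C Y
  have hθs : Function.Surjective θ := by
    intro α
    obtain ⟨β, hβ⟩ := ev_one_extend (Submodule.injective_subtype _) hι
      (exact_ker_subtype ρ) ((hX.dual hC hid).ev hid 0) α
    obtain ⟨y, rfl⟩ := hYb.2 β
    exact ⟨y, hβ⟩
  have hθk : LinearMap.ker θ = LinearMap.range ι := by
    ext y
    constructor
    · intro hy
      obtain ⟨γ, hγ⟩ := (lcomp_exact (C := C) (exact_ker_subtype ρ) hι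
        (bidualityMap R C Y y)).1 hy
      obtain ⟨x, rfl⟩ := hXb.2 γ
      exact ⟨x, hYb.1 hγ⟩
    · rintro ⟨x, rfl⟩
      exact LinearMap.ext fun κ => LinearMap.congr_fun κ.2 x
  exact (hK.dual hC hid).congr ((Submodule.quotEquivOfEq _ _ hθk.symm).trans
    (θ.quotKerEquivOfSurjective hθs))

end Local
end

section
variable {R : Type u} [CommRing R]
variable {C A B D X Y Z : Type u} [AddCommGroup C] [Module R C]
  [AddCommGroup A] [Module R A] [AddCommGroup B] [Module R B]
  [AddCommGroup D] [Module R D] [AddCommGroup X] [Module R X] [AddCommGroup Y] [Module R Y]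
  [AddCommGroup Z] [Module R Z]

lemma SD.self : SD R R where
  finite := inferInstance
  homothety := by
    refine ⟨fun a b h => ?_, fun φ => ⟨φ 1, LinearMap.ext_ring ?_⟩⟩
    · simpa using LinearMap.congr_fun h 1
    · simp
  ev := ev_projective

/-- `R_S` as an `R_S`-module is the localization of the module `R`. -/
def locRing (S : Submonoid R) : LocalizedModule S R ≃ₗ[Localization S] Localization S :=
  (IsLocalizedModule.iso S (Algebra.linearMap R (Localization S))).extendScalarsOfIsLocalization S
    (Localization S)

lemma locHom_mk_one [IsNoetherianRing R] [Module.Finite R A] (S : Submonoid R) (f : A →ₗ[R] B) :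
    locHom S A B (LocalizedModule.mk f 1) = LocalizedModule.map S f := by
  have := Module.finitePresentation_of_finite R A
  change Module.FinitePresentation.linearEquivMapExtendScalars S (LocalizedModule.mk f 1) = _
  rw [Module.FinitePresentation.linearEquivMapExtendScalars]
  exact IsLocalizedModule.linearEquiv_apply S (LocalizedModule.mkLinearMap S (A →ₗ[R] B)) _ f

lemma SD.loc [IsNoetherianRing R] (hC : SD R C) (S : Submonoid R) :
    SD (Localization S) (LocalizedModule S C) where
  finite := have := hC.finite; inferInstance
  homothety := by
    have := hC.finite
    let E : Localization S ≃ₗ[Localization S]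
        (LocalizedModule S C →ₗ[Localization S] LocalizedModule S C) :=
      ((locRing S).symm.trans (locEquiv S (LinearEquiv.ofBijective _ hC.homothety))).trans
        (locHom S C C)
    have h1 : (locRing S).symm 1 = LocalizedModule.mk 1 1 := by
      rw [LinearEquiv.symm_apply_eq]
      exact ((IsLocalizedModule.iso_apply_mk _ _ _ _).trans (by simp)).symm
    have hE : LinearMap.lsmul (Localization S) (LocalizedModule S C) = E.toLinearMap := by
      refine LinearMap.ext_ring ?_
      change _ = locHom S C C (LocalizedModule.map S _ ((locRing S).symm 1))
      rw [h1, LocalizedModule.map_mk, locHom_mk_one]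
      refine LinearMap.ext fun x => ?_
      induction x using LocalizedModule.induction_on with
      | h m s => simp
    rw [hE]
    exact E.bijective
  ev i := have := hC.finite; loc_ev S (hC.ev i)

/-- `depth N_p ≥ t`. -/
def DAt (p : Ideal R) [p.IsPrime] (N : Type u) [AddCommGroup N] [Module R N] (t : ℕ) : Prop :=
  DGE (Localization.AtPrime p) (LocalizedModule p.primeCompl N) t

/-- `depth R_p ≥ t`. -/
def DRing (p : Ideal R) [p.IsPrime] (t : ℕ) : Prop :=
  DGE (Localization.AtPrime p) (Localization.AtPrime p) t

lemma dat_ring_iff (p : Ideal R) [p.IsPrime] {t : ℕ} : DAt p R t ↔ DRing p t :=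
  ⟨fun h => h.congr (locRing p.primeCompl).symm, fun h => h.congr (locRing p.primeCompl)⟩

variable (R) in
/-- Serre's condition `(S̃_n)` in terms of vanishing of `Ext`. -/
def Serre (n : ℕ) (X : Type u) [AddCommGroup X] [Module R X] : Prop :=
  ∀ (p : Ideal R) [p.IsPrime] (t : ℕ), t ≤ n → DRing p t → DAt p X t

lemma serreTilde_iff (n : ℕ) : SerreTilde R n X ↔ Serre R n X := by
  constructor
  · intro h p hp t ht hR
    refine (le_ldepth_iff t).1 (le_trans ?_ (h p hp))
    exact le_min (by exact_mod_cast ht) ((le_ldepth_iff t).2 hR)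
  · intro h p hp
    refine ENat.forall_natCast_le_iff_le.1 fun t ht => (le_ldepth_iff t).2 (h p t ?_ ?_)
    · exact_mod_cast ht.trans (min_le_left _ _)
    · exact (le_ldepth_iff t).1 (ht.trans (min_le_right _ _))

variable (R C) in
/-- `C_p` has finite injective dimension whenever `depth R_p < n`. -/
def FinInjDimAt (n : ℕ) : Prop :=
  ∀ (p : Ideal R) [p.IsPrime], ¬ DRing p n →
    HasFiniteInjDim (Localization.AtPrime p) (LocalizedModule p.primeCompl C)

lemma finInjDimAt_of {n : ℕ}
    (hid : ∀ (p : Ideal R) (_ : p.IsPrime), ringDepthAt R p + 1 ≤ (n : ℕ∞) →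
      HasFiniteInjDim (Localization.AtPrime p) (LocalizedModule p.primeCompl C)) :
    FinInjDimAt R C n := by
  intro p hp h
  refine hid p hp (Order.add_one_le_of_lt (not_le.1 fun h' => h ((le_ldepth_iff n).1 h')))

lemma FinInjDimAt.mono {m n : ℕ} (h : FinInjDimAt R C n) (hmn : m ≤ n) : FinInjDimAt R C m :=
  fun p _ hp => h p fun h' => hp (DGE.mono h' hmn)

lemma Serre.deep {n : ℕ} (h : Serre R n X) (p : Ideal R) [p.IsPrime] (hp : ¬ DRing p n) :
    Deep (Localization.AtPrime p) (LocalizedModule p.primeCompl X) := fun t ht => by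
  refine h p t ?_ ht
  by_contra hlt
  exact hp (DGE.mono ht (by omega))

lemma loc_lcomp_surjective [IsNoetherianRing R] [Module.Finite R A] (S : Submonoid R)
    {ι : A →ₗ[R] B} (h : Function.Surjective (LinearMap.lcomp R C ι)) :
    Function.Surjective
      (LinearMap.lcomp (Localization S) (LocalizedModule S C) (LocalizedModule.map S ι)) := by
  intro φ
  obtain ⟨s, φ', hφ⟩ := loc_hom_lift S φ
  obtain ⟨ψ, rfl⟩ := h φ'
  refine ⟨Localization.mk 1 s • LocalizedModule.map S ψ, ?_⟩
  rw [LinearMap.lcomp_apply', LinearMap.smul_comp, ← loc_map_comp]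
  change _ • LocalizedModule.map S (LinearMap.lcomp R C ι ψ) = _
  rw [← hφ, ← algebraMap_smul (Localization S) (s : R), smul_smul]
  have : Localization.mk 1 s * algebraMap R (Localization S) s = 1 := by
    rw [← Localization.mk_one_eq_algebraMap, Localization.mk_mul, one_mul, mul_one]
    exact Localization.mk_self s
  rw [this, one_smul]

lemma subsingleton_of_dat_one [IsNoetherianRing R]
    (h : ∀ (p : Ideal R) [p.IsPrime], DAt p X 1) : Subsingleton X := by
  by_contra hX
  rw [not_subsingleton_iff_nontrivial] at hX
  obtain ⟨p, hp⟩ := associatedPrimes.nonempty R X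
  obtain ⟨hpp, x, hx⟩ := isAssociatedPrime_iff.1 hp
  have hx' (r : R) : r ∈ p ↔ r • x = 0 := by
    rw [hx]; simp
  let y : LocalizedModule p.primeCompl X := LocalizedModule.mk x 1
  have hle : IsLocalRing.maximalIdeal (Localization.AtPrime p) ≤
      LinearMap.ker (LinearMap.toSpanSingleton _ _ y) := by
    rw [← Localization.AtPrime.map_eq_maximalIdeal, Ideal.map_le_iff_le_comap]
    intro r hr
    rw [Ideal.mem_comap, LinearMap.mem_ker, LinearMap.toSpanSingleton_apply, algebraMap_smul,
      LocalizedModule.smul'_mk, (hx' r).1 hr, LocalizedModule.zero_mk]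
  have h1 := (h p 0 (by omega)).hom_eq_zero (Submodule.liftQ _ _ hle)
  have h2 := LinearMap.congr_fun h1 (Submodule.Quotient.mk 1)
  rw [← Submodule.mkQ_apply, ← LinearMap.comp_apply, Submodule.liftQ_mkQ,
    LinearMap.toSpanSingleton_apply, one_smul] at h2
  obtain ⟨s, hs⟩ := LocalizedModule.mk_eq.1 (h2.trans (LocalizedModule.zero_mk 1).symm)
  have hs' : (s : R) • x = 0 := by simpa [Submonoid.smul_def] using hs
  exact s.2 ((hx' _).2 hs')

lemma deep_of_coker {R : Type u} [CommRing R] [IsNoetherianRing R] [IsLocalRing R]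
    {C X Y Z : Type u} [AddCommGroup C] [Module R C] [AddCommGroup X] [Module R X]
    [AddCommGroup Y] [Module R Y] [AddCommGroup Z] [Module R Z]
    (hC : SD R C) (hid : HasFiniteInjDim R C)
    [Module.Finite R X] [Module.Finite R Y] (hX : Deep R X) (hY : Deep R Y)
    {ι : X →ₗ[R] Y} {g : Y →ₗ[R] Z} (hg : Function.Surjective g) (h : Function.Exact ι g)
    (hι : Function.Surjective (LinearMap.lcomp R C ι)) : Function.Injective ι ∧ Deep R Z := by
  obtain ⟨h1, h2⟩ := Deep.coker hC hid hX hY ι hι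
  exact ⟨h1, h2.congr ((Submodule.quotEquivOfEq _ _ (LinearMap.exact_iff.1 h).symm).trans
    (g.quotKerEquivOfSurjective hg)).symm⟩

variable (R) in
/-- `depth Y_p ≥ depth R_p` for all primes `p`. -/
def GDeep (Y : Type u) [AddCommGroup Y] [Module R Y] : Prop :=
  ∀ (p : Ideal R) [p.IsPrime], Deep (Localization.AtPrime p) (LocalizedModule p.primeCompl Y)

lemma serre_coker [IsNoetherianRing R] (hC : SD R C) {n : ℕ} (hid : FinInjDimAt R C (n + 1))
    [Module.Finite R X] [Module.Finite R Y] (hX : Serre R (n + 1) X) (hY : GDeep R Y)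
    {ι : X →ₗ[R] Y} {g : Y →ₗ[R] Z} (hg : Function.Surjective g) (h : Function.Exact ι g)
    (hι : Function.Surjective (LinearMap.lcomp R C ι)) : Function.Injective ι ∧ Serre R n Z := by
  have good (p : Ideal R) [p.IsPrime] (hp : ¬ DRing p (n + 1)) :
      Function.Injective (LocalizedModule.map p.primeCompl ι) ∧
        Deep (Localization.AtPrime p) (LocalizedModule p.primeCompl Z) :=
    deep_of_coker (hC.loc p.primeCompl) (hid p hp) (hX.deep p hp) (hY p)
      (LocalizedModule.map_surjective p.primeCompl g hg) (loc_exact p.primeCompl h)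
      (loc_lcomp_surjective p.primeCompl hι)
  have hinj : Function.Injective ι := by
    have : Subsingleton (LinearMap.ker ι) := by
      refine subsingleton_of_dat_one (R := R) fun p _ => ?_
      have hi := LocalizedModule.map_injective p.primeCompl (LinearMap.ker ι).subtype
        (Submodule.injective_subtype _)
      by_cases hp : DRing p (n + 1)
      · exact DGE.of_injective hi (hX p 1 (by omega) (DGE.mono hp (by omega)))
      · have h0 := loc_exact p.primeCompl (exact_ker_subtype ι)
        have : Subsingleton (LocalizedModule p.primeCompl (LinearMap.ker ι)) := by
          refine subsingleton_of_forall_eq 0 fun z => hi ?_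
          rw [map_zero]
          refine (good p hp).1 ?_
          rw [map_zero]
          exact (h0 _).2 ⟨z, rfl⟩
        exact fun i _ => ev_subsingleton_right i
    rw [← LinearMap.ker_eq_bot]
    exact Submodule.subsingleton_iff_eq_bot.1 this
  refine ⟨hinj, fun p _ t ht hR => ?_⟩
  by_cases hp : DRing p (n + 1)
  · exact dge_right (LocalizedModule.map_injective p.primeCompl ι hinj)
      (LocalizedModule.map_surjective p.primeCompl g hg) (loc_exact p.primeCompl h)
      (hY p t hR) (hX p _ (by omega) (DGE.mono hp (by omega)))
  · exact (good p hp).2 t hR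

end

section
variable {R : Type u} [CommRing R]
variable {C A B D X Y Z : Type u} [AddCommGroup C] [Module R C]
  [AddCommGroup A] [Module R A] [AddCommGroup B] [Module R B]
  [AddCommGroup D] [Module R D] [AddCommGroup X] [Module R X] [AddCommGroup Y] [Module R Y]
  [AddCommGroup Z] [Module R Z]

lemma DAt.congr {p : Ideal R} [p.IsPrime] {t : ℕ} (h : DAt p X t) (e : Y ≃ₗ[R] X) : DAt p Y t :=
  DGE.congr h (locEquiv p.primeCompl e)

lemma GDeep.finsupp [IsNoetherianRing R] (h : GDeep R X) (ι : Type u) : GDeep R (ι →₀ X) :=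
  fun p _ t ht => DGE.congr (fun i hi => ev_finsupp ι (h p t ht i hi)) (locFinsupp p.primeCompl ι X)

lemma GDeep.retract {f : X →ₗ[R] Y} {g : Y →ₗ[R] X} (hgf : g ∘ₗ f = LinearMap.id)
    (h : GDeep R Y) : GDeep R X := fun p _ t ht i hi =>
  (h p t ht i hi).retract_right (LocalizedModule.map p.primeCompl f)
    (LocalizedModule.map p.primeCompl g) (by
      rw [← loc_map_comp, hgf]
      refine LinearMap.ext fun x => ?_
      induction x using LocalizedModule.induction_on with
      | h m s => simp)

lemma GDeep.congr (h : GDeep R X) (e : Y ≃ₗ[R] X) : GDeep R Y :=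
  GDeep.retract (f := e.toLinearMap) (g := e.symm.toLinearMap) (by simp) h

lemma GDeep.pi [IsNoetherianRing R] (h : GDeep R X) (k : ℕ) : GDeep R (Fin k → X) :=
  (h.finsupp (ULift.{u} (Fin k))).congr
    ((Finsupp.linearEquivFunOnFinite R X (Fin k)).symm.trans
      (Finsupp.domLCongr Equiv.ulift.symm))

lemma SD.gdeep [IsNoetherianRing R] (hC : SD R C) : GDeep R C :=
  fun p _ => (hC.loc p.primeCompl).deep

lemma GDeep.tensor [IsNoetherianRing R] (h : GDeep R C) (P : Type u) [AddCommGroup P] [Module R P]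
    [Module.Projective R P] : GDeep R (TensorProduct R P C) := by
  obtain ⟨s, hs⟩ := Module.projective_lifting_property (Finsupp.linearCombination R (id : P → P))
    LinearMap.id (Finsupp.linearCombination_id_surjective R P)
  refine GDeep.retract (Y := TensorProduct R (P →₀ R) C) (f := s.rTensor C)
    (g := (Finsupp.linearCombination R (id : P → P)).rTensor C)
    (by rw [← LinearMap.rTensor_comp, hs, LinearMap.rTensor_id]) ?_
  classical
  exact (h.finsupp P).congr (TensorProduct.finsuppScalarLeft R C P)

lemma serre_of_isNthCSyzygyAux [IsNoetherianRing R] (h : GDeep R C) (n : ℕ) (X : ModuleCat.{u} R)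
    (hX : IsNthCSyzygyAux R C n X) : Serre R n X := by
  induction n generalizing X with
  | zero =>
    intro p _ t ht _
    obtain rfl : t = 0 := by omega
    exact dge_zero
  | succ n ih =>
    obtain ⟨P, hP, ι, hι, hZ⟩ := hX
    intro p _ t ht hR
    cases t with
    | zero => exact dge_zero
    | succ t =>
      exact dge_left (LocalizedModule.map_injective p.primeCompl ι hι)
        (LocalizedModule.map_surjective p.primeCompl _ (Submodule.mkQ_surjective _))
        (loc_exact p.primeCompl (LinearMap.exact_map_mkQ_range ι)) (h.tensor P p _ hR)
        (ih _ hZ p t (by omega) (DGE.mono hR (by omega)))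

lemma isNthCSyzygyAux_congr (n : ℕ) {X Y : ModuleCat.{u} R} (e : X ≃ₗ[R] Y)
    (h : IsNthCSyzygyAux R C n X) : IsNthCSyzygyAux R C n Y := by
  induction n generalizing X Y with
  | zero => trivial
  | succ n ih =>
    obtain ⟨P, hP, ι, hι, hZ⟩ := h
    refine ⟨P, hP, ι ∘ₗ e.symm.toLinearMap, hι.comp e.symm.injective, ih ?_ hZ⟩
    exact Submodule.quotEquivOfEq _ _ (LinearEquiv.range_comp e.symm ι).symm

variable (R C) in
/-- `X` is an `n`-th syzygy of finite powers of `C`, where each step stays exact under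
`Hom(-, C)`. -/
def CPush : ℕ → (X : Type u) → [AddCommGroup X] → [Module R X] → Prop
  | 0, _, _, _ => True
  | n + 1, X, _, _ => ∃ (k : ℕ) (Z : ModuleCat.{u} R) (ι : X →ₗ[R] (Fin k → C))
      (g : (Fin k → C) →ₗ[R] Z), Function.Injective ι ∧ Function.Surjective g ∧
        Function.Exact ι g ∧ Function.Surjective (LinearMap.lcomp R C ι) ∧ CPush n Z

lemma CPush.isNthCSyzygyAux (n : ℕ) (X : ModuleCat.{u} R) (h : CPush R C n X) :
    IsNthCSyzygyAux R C n X := by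
  induction n generalizing X with
  | zero => trivial
  | succ n ih =>
    obtain ⟨k, Z, ι, g, hι, hg, hex, -, hZ⟩ := h
    classical
    let e : TensorProduct R (ULift.{u} (Fin k) →₀ R) C ≃ₗ[R] (Fin k → C) :=
      (TensorProduct.finsuppScalarLeft R C _).trans ((Finsupp.domLCongr Equiv.ulift).trans
        (Finsupp.linearEquivFunOnFinite R C (Fin k)))
    refine ⟨ModuleCat.of R (ULift.{u} (Fin k) →₀ R), inferInstance, e.symm.toLinearMap ∘ₗ ι,
      e.symm.injective.comp hι, isNthCSyzygyAux_congr n ?_ (ih Z hZ)⟩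
    have hk : LinearMap.range (e.symm.toLinearMap ∘ₗ ι) = LinearMap.ker (g ∘ₗ e.toLinearMap) := by
      ext y
      rw [LinearMap.mem_ker, LinearMap.comp_apply, LinearMap.mem_range]
      refine Iff.trans ?_ (hex (e y)).symm
      exact ⟨fun ⟨x, hx⟩ => ⟨x, e.symm.injective (by simpa using hx)⟩,
        fun ⟨x, hx⟩ => ⟨x, by simp [hx]⟩⟩
    exact ((Submodule.quotEquivOfEq _ _ hk).trans
      ((g ∘ₗ e.toLinearMap).quotKerEquivOfSurjective (hg.comp e.surjective))).symm

lemma exists_dual_generators [IsNoetherianRing R] (X C : Type u) [AddCommGroup X] [Module R X]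
    [AddCommGroup C] [Module R C] [Module.Finite R X] [Module.Finite R C] :
    ∃ (k : ℕ) (ι : X →ₗ[R] (Fin k → C)), Function.Surjective (LinearMap.lcomp R C ι) := by
  obtain ⟨k, s, hs⟩ := exists_free_cover R (X →ₗ[R] C)
  refine ⟨k, LinearMap.pi fun j => s (Pi.single j 1), fun φ => ?_⟩
  obtain ⟨a, rfl⟩ := hs φ
  refine ⟨∑ j, a j • LinearMap.proj j, LinearMap.ext fun x => ?_⟩
  have ha : a = ∑ j, a j • Pi.single (M := fun _ : Fin k => R) j 1 := by
    ext i
    simp [Finset.sum_apply, Pi.single_apply]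
  conv_rhs => rw [ha, map_sum]
  simp [LinearMap.sum_apply]

lemma Serre.cpush [IsNoetherianRing R] (hC : SD R C) {n : ℕ} (hid : FinInjDimAt R C n)
    [Module.Finite R X] (hX : Serre R n X) : CPush R C n X := by
  have := hC.finite
  induction n generalizing X with
  | zero => trivial
  | succ n ih =>
    obtain ⟨k, ι, hι⟩ := exists_dual_generators (R := R) X C
    obtain ⟨h1, h2⟩ := serre_coker hC hid hX (hC.gdeep.pi k) (Submodule.mkQ_surjective _)
      (LinearMap.exact_map_mkQ_range ι) hι
    exact ⟨k, ModuleCat.of R ((Fin k → C) ⧸ LinearMap.range ι), ι, Submodule.mkQ _, h1,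
      Submodule.mkQ_surjective _, LinearMap.exact_map_mkQ_range ι, hι,
      ih (hid.mono (by omega)) h2⟩

lemma SD.projective_dual_pi (hC : SD R C) (k : ℕ) : Module.Projective R ((Fin k → C) →ₗ[R] C) :=
  Module.Projective.of_equiv ((LinearEquiv.piCongrRight fun _ : Fin k =>
    LinearEquiv.ofBijective _ hC.homothety).trans <| LinearMap.lsum R (fun _ : Fin k => C) R)

lemma CPush.bidual_injective (hC : SD R C) {n : ℕ} (h : CPush R C (n + 1) X) :
    Function.Injective (bidualityMap R C X) := by
  obtain ⟨k, Z, ι, g, hι, -⟩ := h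
  exact bidual_injective_of_injective hι
    (bidual_bijective_pi k (bidual_bijective_self hC.homothety)).1

lemma CPush.bidual_surjective (hC : SD R C) {n : ℕ} (h : CPush R C (n + 2) X) :
    Function.Surjective (bidualityMap R C X) := by
  obtain ⟨k, Z, ι, g, hι, hg, hex, hs, hZ⟩ := h
  intro α
  obtain ⟨e, he⟩ := (bidual_bijective_pi k (bidual_bijective_self hC.homothety)).2
    (α ∘ₗ LinearMap.lcomp R C ι)
  have hge : g e = 0 := by
    refine hZ.bidual_injective hC (bidual_eq_iff.2 fun φ => ?_)
    have h1 := LinearMap.congr_fun he (φ ∘ₗ g)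
    rw [bidual_apply] at h1
    rw [map_zero]
    refine h1.trans ?_
    rw [LinearMap.comp_apply, LinearMap.lcomp_apply', LinearMap.comp_assoc,
      hex.linearMap_comp_eq_zero, LinearMap.comp_zero, map_zero]
  obtain ⟨x, rfl⟩ := (hex e).1 hge
  refine ⟨x, LinearMap.ext fun φ => ?_⟩
  obtain ⟨ψ, rfl⟩ := hs φ
  exact LinearMap.congr_fun he ψ

lemma CPush.ev_dual (hC : SD R C) {n : ℕ} (h : CPush R C n X) (i : ℕ) (hi : 0 < i)
    (hin : i + 1 < n) : EV R (X →ₗ[R] C) C i := by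
  induction i generalizing n X with
  | zero => omega
  | succ i ih =>
    obtain ⟨n, rfl⟩ : ∃ m, n = m + 3 := ⟨n - 3, by omega⟩
    obtain ⟨k, Z, ι, g, hι, hg, hex, hs, hZ⟩ := h
    have := hC.projective_dual_pi k
    cases i with
    | zero =>
      refine ev_one_of_extend (lcomp_injective hg) hs (lcomp_exact hex hg) (ev_projective 0)
        fun φ => ?_
      obtain ⟨z, rfl⟩ := hZ.bidual_surjective hC φ
      obtain ⟨e, rfl⟩ := hg z
      exact ⟨bidualityMap R C _ e, rfl⟩
    | succ i =>
      exact ev_con₃ (lcomp_injective hg) hs (lcomp_exact hex hg) (ev_projective _)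
        (ih hZ (by omega) (by omega))

/-- The `Ext`-vanishing of the cokernel of `Hom(X, C) → Hom(P, C)`. -/
lemma CPush.ev_coker (hC : SD R C) {n : ℕ} (h : CPush R C n X) {P N : Type u} [AddCommGroup P]
    [Module R P] [AddCommGroup N] [Module R N] (hP : ∀ i, EV R (P →ₗ[R] C) C (i + 1))
    {π : P →ₗ[R] X} (hπ : Function.Surjective π) {q : (P →ₗ[R] C) →ₗ[R] N}
    (hq : Function.Surjective q) (hex : Function.Exact (LinearMap.lcomp R C π) q) (i : ℕ)
    (hi : 0 < i) (hin : i < n) : EV R N C i := by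
  obtain ⟨i, rfl⟩ : ∃ j, i = j + 1 := ⟨i - 1, by omega⟩
  cases i with
  | zero =>
    refine ev_one_of_extend (lcomp_injective hπ) hq hex (hP 0) fun φ => ?_
    obtain ⟨n, rfl⟩ : ∃ m, n = m + 2 := ⟨n - 2, by omega⟩
    obtain ⟨x, rfl⟩ := h.bidual_surjective hC φ
    obtain ⟨e, rfl⟩ := hπ x
    exact ⟨bidualityMap R C _ e, rfl⟩
  | succ i =>
    exact ev_con₃ (lcomp_injective hπ) hq hex (hP _) (h.ev_dual hC _ (by omega) (by omega))

end

section
variable {R : Type u} [CommRing R]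
variable {C A B D X Y Z M N P Q : Type u} [AddCommGroup C] [Module R C]
  [AddCommGroup A] [Module R A] [AddCommGroup B] [Module R B]
  [AddCommGroup D] [Module R D] [AddCommGroup X] [Module R X] [AddCommGroup Y] [Module R Y]
  [AddCommGroup Z] [Module R Z] [AddCommGroup M] [Module R M] [AddCommGroup N] [Module R N]
  [AddCommGroup P] [Module R P] [AddCommGroup Q] [Module R Q]

lemma ev_pi_left {i : ℕ} (h : EV R X Y i) (k : ℕ) : EV R (Fin k → X) Y i := by
  induction k with
  | zero => exact ev_subsingleton_left i
  | succ k ih =>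
    refine EV.congr_left (B := X × (Fin k → X)) ?_ (Fin.consLinearEquiv R fun _ => X).symm
    exact ev_con₂ (LinearMap.inl_injective) LinearMap.snd_surjective Function.Exact.inl_snd h ih

lemma exists_dual_retract [Module.Finite R P] [Module.Projective R P] (C : Type u)
    [AddCommGroup C] [Module R C] :
    ∃ (k : ℕ) (f : (P →ₗ[R] C) →ₗ[R] (Fin k → C)) (g : (Fin k → C) →ₗ[R] (P →ₗ[R] C)),
      g ∘ₗ f = LinearMap.id := by
  obtain ⟨k, q, hq⟩ := exists_free_cover R P
  obtain ⟨s, hs⟩ := Module.projective_lifting_property q LinearMap.id hq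
  refine ⟨k, (homFinEquiv k C).toLinearMap ∘ₗ LinearMap.lcomp R C q,
    LinearMap.lcomp R C s ∘ₗ (homFinEquiv k C).symm.toLinearMap, LinearMap.ext fun φ => ?_⟩
  change ((homFinEquiv k C).symm ((homFinEquiv k C) (φ ∘ₗ q))) ∘ₗ s = φ
  rw [LinearEquiv.symm_apply_apply, LinearMap.comp_assoc, hs, LinearMap.comp_id]

lemma SD.ev_dual_projective (hC : SD R C) [Module.Finite R P] [Module.Projective R P] (i : ℕ) :
    EV R (P →ₗ[R] C) C (i + 1) := by
  obtain ⟨k, f, g, h⟩ := exists_dual_retract (R := R) (P := P) C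
  exact (ev_pi_left (hC.ev i) k).retract_left f g h

lemma SD.gdeep_dual_projective [IsNoetherianRing R] (hC : SD R C) [Module.Finite R P]
    [Module.Projective R P] : GDeep R (P →ₗ[R] C) := by
  obtain ⟨k, f, g, h⟩ := exists_dual_retract (R := R) (P := P) C
  exact (hC.gdeep.pi k).retract h

lemma dat_hom [IsNoetherianRing R] [Module.Finite R Z] (p : Ideal R) [p.IsPrime] {t : ℕ}
    (hE : ∀ i, 0 < i → i + 1 < t → EV R Z N i) (hN : DAt p N t) : DAt p (Z →ₗ[R] N) t := by
  refine DGE.congr (dge_hom (fun i h0 h1 => ?_) hN) (locHom p.primeCompl Z N)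
  obtain ⟨i, rfl⟩ : ∃ j, i = j + 1 := ⟨i - 1, by omega⟩
  exact loc_ev p.primeCompl (hE _ h0 h1)

lemma SD.dat_of_dat_hom [IsNoetherianRing R] (hC : SD R C) [Module.Finite R M]
    (hE : ∀ i, EV R C M (i + 1)) (p : Ideal R) [p.IsPrime] {t : ℕ} (h : DAt p (C →ₗ[R] M) t) :
    DAt p M t := by
  have := hC.finite
  have := (hC.loc p.primeCompl).nontrivial
  exact dge_of_dge_hom (fun i => loc_ev p.primeCompl (hE i))
    (DGE.congr h (locHom p.primeCompl C M).symm)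

lemma Serre.hom [IsNoetherianRing R] [Module.Finite R C] {n : ℕ} (h : Serre R n M)
    (hE : ∀ i, EV R C M (i + 1)) : Serre R n (C →ₗ[R] M) := by
  intro p _ t ht hR
  refine dat_hom p (fun i h0 _ => ?_) (h p t ht hR)
  obtain ⟨i, rfl⟩ : ∃ j, i = j + 1 := ⟨i - 1, by omega⟩
  exact hE i

lemma exact_of_presentation {f : A →ₗ[R] B} {g : B →ₗ[R] D}
    (h : LinearMap.range f = LinearMap.ker g) : Function.Exact f g :=
  LinearMap.exact_iff.2 h.symm

lemma lcomp_rangeRestrict_exact {f : A →ₗ[R] B} {g : B →ₗ[R] D} (h : Function.Exact f g)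
    (hg : Function.Surjective g) :
    Function.Exact (LinearMap.lcomp R C g) (LinearMap.lcomp R C f).rangeRestrict := by
  intro φ
  rw [← LinearMap.mem_ker, LinearMap.ker_rangeRestrict, LinearMap.mem_ker]
  exact lcomp_exact h hg φ

/-- `Ext^i(λ_R(C, M), C)` vanishes for `0 < i < n` if `M` satisfies `(S̃_n)`. -/
lemma Serre.ev_lambda [IsNoetherianRing R] (hC : SD R C) {n : ℕ} (hid : FinInjDimAt R C n)
    [Module.Finite R M] (hE : ∀ i, EV R C M (i + 1)) (hM : Serre R n M)
    (hN : IsLambdaOf R C M N) (i : ℕ) (hi : 0 < i) (hin : i < n) : EV R N C i := by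
  have := hC.finite
  obtain ⟨pres, ⟨e⟩⟩ := hN
  have := pres.finite₀
  have := pres.proj₀
  have hX : CPush R C n (C →ₗ[R] M) := (hM.hom hE).cpush hC hid
  exact (hX.ev_coker hC (fun i => hC.ev_dual_projective i) pres.surj
    (LinearMap.surjective_rangeRestrict _)
    (lcomp_rangeRestrict_exact (exact_of_presentation pres.exact) pres.surj) i hi hin).congr_left e

lemma IsLambdaOf.exists_embedding (hM : IsLambdaOf R C N M) :
    ∃ (pres : MinPres R (C →ₗ[R] N)) (κ : M →ₗ[R] (pres.P₁ →ₗ[R] C)), Function.Injective κ ∧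
      LinearMap.range κ = LinearMap.range (LinearMap.lcomp R C pres.f) := by
  obtain ⟨pres, ⟨e⟩⟩ := hM
  refine ⟨pres, Submodule.subtype _ ∘ₗ e.toLinearMap,
    (Submodule.injective_subtype _).comp e.injective, ?_⟩
  rw [LinearMap.range_comp, LinearEquiv.range, Submodule.map_top, Submodule.range_subtype]
  rfl

lemma IsLambdaOf.dat_one [IsNoetherianRing R] (hC : SD R C) (hM : IsLambdaOf R C N M)
    (p : Ideal R) [p.IsPrime] {t : ℕ} (ht : t ≤ 1) (hR : DRing p t) : DAt p M t := by
  obtain ⟨pres, κ, hκ, -⟩ := hM.exists_embedding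
  have := pres.finite₁
  have := pres.proj₁
  interval_cases t
  · exact dge_zero
  · exact DGE.of_injective (LocalizedModule.map_injective p.primeCompl κ hκ)
      (hC.gdeep_dual_projective p 1 hR)

lemma IsLambdaOf.bidual_injective (hM : IsLambdaOf R C N M) :
    Function.Injective (bidualityMap R C (A →ₗ[R] M)) := by
  obtain ⟨pres, κ, hκ, -⟩ := hM.exists_embedding
  intro x y hxy
  refine LinearMap.ext fun c => hκ (LinearMap.ext fun q => ?_)
  exact bidual_eq_iff.1 hxy (LinearMap.applyₗ q ∘ₗ κ ∘ₗ LinearMap.applyₗ c)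

/-- If `M` and `N` are linked and `Ext^i(N, C)` vanishes for `0 < i < n`, then `M` satisfies
`(S̃_n)`. -/
lemma serre_of_ev_lambda [IsNoetherianRing R] (hC : SD R C) {n : ℕ}
    [Module.Finite R M] (hE : ∀ i, EV R C M (i + 1)) (hN : IsLambdaOf R C M N)
    (hM : IsLambdaOf R C N M) (h : ∀ i, 0 < i → i < n → EV R N C i) : Serre R n M := by
  have := hC.finite
  intro p _ t ht hR
  by_cases ht1 : t ≤ 1
  · exact hM.dat_one hC p ht1 hR
  have hinj : Function.Injective (bidualityMap R C (C →ₗ[R] M)) := hM.bidual_injective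
  obtain ⟨pres, ⟨e⟩⟩ := hN
  have := pres.finite₀
  have := pres.proj₀
  have hi := lcomp_injective (C := C) pres.surj
  have hs := LinearMap.surjective_rangeRestrict (LinearMap.lcomp R C pres.f)
  have hx := lcomp_rangeRestrict_exact (C := C) (exact_of_presentation pres.exact) pres.surj
  have hN' (i : ℕ) (h0 : 0 < i) (h1 : i < n) :
      EV R (LinearMap.range (LinearMap.lcomp R C pres.f)) C i :=
    (h i h0 h1).congr_left e.symm
  have hsurj : Function.Surjective (bidualityMap R C (C →ₗ[R] M)) := by
    intro α
    obtain ⟨β, rfl⟩ := ev_one_extend hi hs hx (hN' 1 (by omega) (by omega)) α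
    obtain ⟨q, rfl⟩ := (bidual_bijective_projective (X := pres.P₀) hC.homothety).2 β
    exact ⟨pres.g q, rfl⟩
  refine hC.dat_of_dat_hom hE p (DAt.congr (dat_hom p (fun i h0 h1 => ?_) (hC.gdeep p t hR))
    (LinearEquiv.ofBijective _ ⟨hinj, hsurj⟩))
  obtain ⟨i, rfl⟩ : ∃ j, i = j + 1 := ⟨i - 1, by omega⟩
  exact ev_con₁ hi hs hx (hC.ev_dual_projective i) (hN' _ (by omega) (by omega))

variable (R C) in
/-- The map `Hom(P, R) → Hom(C, Hom(P, C))`, `y ↦ (c ↦ (x ↦ y x • c))`. -/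
def homothetyHom (P : Type u) [AddCommGroup P] [Module R P] :
    (P →ₗ[R] R) →ₗ[R] (C →ₗ[R] (P →ₗ[R] C)) where
  toFun y := (LinearMap.lsmul R C ∘ₗ y).flip
  map_add' y z := by ext; simp
  map_smul' r y := by ext; simp [mul_smul]

lemma homothetyHom_apply (y : P →ₗ[R] R) (c : C) (x : P) :
    homothetyHom R C P y c x = y x • c := rfl

lemma homothetyHom_bijective (h : Function.Bijective (LinearMap.lsmul R C)) :
    Function.Bijective (homothetyHom R C P) := by
  constructor
  · intro y z hyz
    refine LinearMap.ext fun x => h.1 (LinearMap.ext fun c => ?_)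
    exact LinearMap.congr_fun (LinearMap.congr_fun hyz c) x
  · intro φ
    let e := LinearEquiv.ofBijective _ h
    refine ⟨e.symm.toLinearMap ∘ₗ φ.flip, LinearMap.ext fun c => LinearMap.ext fun x => ?_⟩
    exact LinearMap.congr_fun (e.apply_symm_apply (φ.flip x)) c

/-- If `M` is identified with the image of `Hom(P₀, C) → Hom(P₁, C)`, then `Hom(C, M)` is a
submodule of `Hom(P₁, R)`. -/
lemma homEquivComap (h : Function.Bijective (LinearMap.lsmul R C)) {f : P →ₗ[R] Q}
    {κ : M →ₗ[R] (P →ₗ[R] C)} (hκ : Function.Injective κ)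
    (hr : LinearMap.range κ = LinearMap.range (LinearMap.lcomp R C f)) :
    ∃ V : Submodule R (P →ₗ[R] R), Nonempty ((C →ₗ[R] M) ≃ₗ[R] V) ∧
      (∀ y, y ∈ V ↔ ∀ c, homothetyHom R C P y c ∈ LinearMap.range (LinearMap.lcomp R C f)) ∧
      (∀ y ∈ V, ∀ a, f a = 0 → y a = 0) ∧
      ∀ y : Q →ₗ[R] R, LinearMap.lcomp R R f y ∈ V := by
  let e := LinearEquiv.ofBijective _ (homothetyHom_bijective (P := P) h)
  let j : (C →ₗ[R] M) →ₗ[R] (P →ₗ[R] R) := e.symm.toLinearMap ∘ₗ κ.compRight R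
  have hj : Function.Injective j := e.symm.injective.comp fun a b hab =>
    LinearMap.ext fun c => hκ (LinearMap.congr_fun hab c)
  have hmem (y : P →ₗ[R] R) : y ∈ LinearMap.range j ↔
      ∀ c, homothetyHom R C P y c ∈ LinearMap.range (LinearMap.lcomp R C f) := by
    rw [← hr]
    constructor
    · rintro ⟨x, rfl⟩ c
      refine ⟨x c, ?_⟩
      exact (LinearMap.congr_fun (e.apply_symm_apply (κ ∘ₗ x)) c).symm
    · intro hy
      let eκ := LinearEquiv.ofInjective κ hκ
      refine ⟨eκ.symm.toLinearMap ∘ₗ (homothetyHom R C P y).codRestrict _ hy, ?_⟩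
      refine e.symm_apply_eq.2 (LinearMap.ext fun c => ?_)
      exact congrArg Subtype.val (eκ.apply_symm_apply ⟨_, hy c⟩)
  refine ⟨LinearMap.range j, ⟨LinearEquiv.ofInjective j hj⟩, hmem, fun y hy a ha => ?_,
    fun y => (hmem _).2 fun c => ⟨homothetyHom R C Q y c, rfl⟩⟩
  refine h.1 (LinearMap.ext fun c => ?_)
  obtain ⟨ψ, hψ⟩ := (hmem y).1 hy c
  have := LinearMap.congr_fun hψ a
  rw [LinearMap.lcomp_apply, ha, map_zero, homothetyHom_apply] at this
  rw [map_zero, LinearMap.zero_apply, LinearMap.lsmul_apply, ← this]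

/-- If `M` is linked to `N` and `Ext^i(Hom(C, N), R)` vanishes for `0 < i < n`, then `M` satisfies
`(S̃_n)`. -/
lemma serre_of_ev_hom_lambda [IsNoetherianRing R] (hC : SD R C) {n : ℕ}
    [Module.Finite R M] (hE : ∀ i, EV R C M (i + 1))
    (hM : IsLambdaOf R C N M) (h : ∀ i, 0 < i → i < n → EV R (C →ₗ[R] N) R i) :
    Serre R n M := by
  have := hC.finite
  intro p _ t ht hR
  by_cases ht1 : t ≤ 1
  · exact hM.dat_one hC p ht1 hR
  obtain ⟨pres, κ, hκ, hr⟩ := hM.exists_embedding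
  have := pres.finite₀
  have := pres.proj₀
  obtain ⟨V, ⟨e⟩, hV, hV0, -⟩ := homEquivComap hC.homothety hκ hr
  have hi := Submodule.injective_subtype (LinearMap.ker pres.g)
  have hx := exact_ker_subtype pres.g
  have hf (a : pres.P₁) : pres.f a ∈ LinearMap.ker pres.g := pres.exact ▸ ⟨a, rfl⟩
  let f' : pres.P₁ →ₗ[R] LinearMap.ker pres.g := pres.f.codRestrict _ hf
  have hf' : Function.Surjective f' := by
    rintro ⟨b, hb⟩
    rw [← pres.exact] at hb
    obtain ⟨a, rfl⟩ := hb
    exact ⟨a, rfl⟩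
  have hrange : LinearMap.range (LinearMap.lcomp R R f') = V := by
    ext y
    constructor
    · rintro ⟨ψ, rfl⟩
      obtain ⟨ψ', rfl⟩ := ev_one_extend hi pres.surj hx (h 1 (by omega) (by omega)) ψ
      exact (hV _).2 fun c => ⟨homothetyHom R C _ ψ' c, rfl⟩
    · intro hy
      have hex := lcomp_exact (C := R) (exact_ker_subtype f') hf'
      refine (hex y).1 (LinearMap.ext fun a => hV0 y hy a ?_)
      exact congrArg Subtype.val a.2
  let e' : (LinearMap.ker pres.g →ₗ[R] R) ≃ₗ[R] V :=
    (LinearEquiv.ofInjective _ (lcomp_injective hf')).trans (LinearEquiv.ofEq _ _ hrange)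
  refine hC.dat_of_dat_hom hE p (DAt.congr (dat_hom (Z := LinearMap.ker pres.g) p
    (fun i h0 h1 => ?_) ((dat_ring_iff p).2 hR)) (e.trans e'.symm))
  obtain ⟨i, rfl⟩ : ∃ j, i = j + 1 := ⟨i - 1, by omega⟩
  exact ev_con₁ hi pres.surj hx (ev_projective i) (h _ (by omega) (by omega))

end

section
variable {R : Type u} [CommRing R]

lemma exists_resolution_injective (X C : Type u) [AddCommGroup X] [Module R X] [AddCommGroup C]
    [Module R C] (h : Subsingleton (TorGrp R X C 1)) :
    ∃ (P : ModuleCat.{u} R) (π : P →ₗ[R] C), Module.Projective R P ∧ Function.Surjective π ∧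
      Function.Injective ((LinearMap.ker π).subtype.rTensor X) := by
  let P := projectiveResolution (ModuleCat.of R C)
  let F := (MonoidalCategory.tensoringLeft (ModuleCat.{u} R)).obj (ModuleCat.of R X)
  have hz : Limits.IsZero (((F.mapHomologicalComplex _).obj P.complex).homology 1) :=
    (ModuleCat.isZero_iff_subsingleton.2 h).of_iso (P.isoLeftDerivedObj F 1).symm
  rw [← HomologicalComplex.exactAt_iff_isZero_homology,
    HomologicalComplex.exactAt_iff' _ 2 1 0 (by simp) (by simp),
    ShortComplex.moduleCat_exact_iff] at hz
  have hex : ∀ t : TensorProduct R X (P.complex.X 1),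
      (P.complex.d 1 0).hom.lTensor X t = 0 → ∃ s : TensorProduct R X (P.complex.X 2),
        (P.complex.d 2 1).hom.lTensor X s = t := hz
  let e := HomologicalComplex.singleObjXSelf (ComplexShape.down ℕ) 0 (ModuleCat.of R C)
  let π : P.complex.X 0 ⟶ ModuleCat.of R C := P.π.f 0 ≫ e.hom
  have hepi : Epi π := inferInstance
  have h0 := P.exact₀
  rw [ShortComplex.moduleCat_exact_iff] at h0
  have hproj : Module.Projective R (P.complex.X 0) :=
    (IsProjective.iff_projective _).2 (P.projective 0)
  have hd (a : P.complex.X 1) : (P.complex.d 1 0).hom a ∈ LinearMap.ker π.hom := by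
    have := LinearMap.congr_fun (congrArg ModuleCat.Hom.hom P.complex_d_comp_π_f_zero) a
    exact (congrArg e.hom.hom this).trans (map_zero _)
  let d : P.complex.X 1 →ₗ[R] LinearMap.ker π.hom := (P.complex.d 1 0).hom.codRestrict _ hd
  have hds : Function.Surjective d := by
    rintro ⟨b, hb⟩
    have h1 : e.hom.hom ((P.π.f 0).hom b) = 0 := hb
    have h2 : (P.π.f 0).hom b = 0 := by
      have := congrArg e.inv.hom h1
      rwa [← ModuleCat.comp_apply, e.hom_inv_id, ModuleCat.id_apply, map_zero] at this
    obtain ⟨a, ha⟩ := h0 b h2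
    exact ⟨a, Subtype.ext ha⟩
  refine ⟨P.complex.X 0, π.hom, hproj, (ModuleCat.epi_iff_surjective _).1 hepi,
    (LinearMap.lTensor_inj_iff_rTensor_inj _ _).1 ?_⟩
  rw [injective_iff_map_eq_zero]
  intro t ht
  obtain ⟨t, rfl⟩ := LinearMap.lTensor_surjective X hds t
  rw [← LinearMap.comp_apply, ← LinearMap.lTensor_comp] at ht
  obtain ⟨s, rfl⟩ := hex t ht
  rw [← LinearMap.comp_apply, ← LinearMap.lTensor_comp]
  have : d ∘ₗ (P.complex.d 2 1).hom = 0 := by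
    refine LinearMap.ext fun x => Subtype.ext ?_
    have := LinearMap.congr_fun (congrArg ModuleCat.Hom.hom (P.complex.d_comp_d 2 1 0)) x
    exact this
  rw [this, LinearMap.lTensor_zero, LinearMap.zero_apply]

lemma lTensor_injective_of_tor {X C K F : Type u} [AddCommGroup X] [Module R X] [AddCommGroup C]
    [Module R C] [AddCommGroup K] [Module R K] [AddCommGroup F] [Module R F]
    (h : Subsingleton (TorGrp R X C 1)) {i : K →ₗ[R] F} {g : F →ₗ[R] X}
    (hi : Function.Injective i) (hg : Function.Surjective g) (hx : Function.Exact i g) :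
    Function.Injective (i.lTensor C) := by
  obtain ⟨P, π, hP, hπ, hinj⟩ := exists_resolution_injective X C h
  exact lTensor_injective_of_exact_of_exact_of_rTensor_injective (exact_ker_subtype π) hπ hx hg
    hinj (Module.Flat.lTensor_preserves_injective_linearMap i hi)
end

section
variable {R : Type u} [CommRing R] {C M B Z : Type u} [AddCommGroup C] [Module R C]
  [AddCommGroup M] [Module R M] [AddCommGroup B] [Module R B] [AddCommGroup Z] [Module R Z]

variable (R C) in
/-- The map `R^k → Hom(C, C^k)`, `y ↦ (c ↦ (j ↦ y j • c))`. -/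
def piHomothety (k : ℕ) : (Fin k → R) →ₗ[R] (C →ₗ[R] (Fin k → C)) where
  toFun y := LinearMap.pi fun j => LinearMap.lsmul R C (y j)
  map_add' y z := by ext; simp
  map_smul' r y := by ext; simp [mul_smul]

lemma piHomothety_apply (k : ℕ) (y : Fin k → R) (c : C) (j : Fin k) :
    piHomothety R C k y c j = y j • c := rfl

lemma piHomothety_bijective (h : Function.Bijective (LinearMap.lsmul R C)) (k : ℕ) :
    Function.Bijective (piHomothety R C k) := by
  constructor
  · intro y z hyz
    refine funext fun j => h.1 (LinearMap.ext fun c => ?_)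
    exact congrFun (LinearMap.congr_fun hyz c) j
  · intro φ
    choose y hy using fun j => h.2 (LinearMap.proj j ∘ₗ φ)
    exact ⟨y, LinearMap.ext fun c => funext fun j => LinearMap.congr_fun (hy j) c⟩

lemma evalMap_tmul (c : C) (x : C →ₗ[R] M) : evalMap R C M (TensorProduct.tmul R c x) = x c := rfl

lemma evalMap_naturality (f : M →ₗ[R] B) (t : TensorProduct R C (C →ₗ[R] M)) :
    evalMap R C B ((f.compRight R).lTensor C t) = f (evalMap R C M t) := by
  induction t with
  | zero => simp
  | tmul c x => rfl
  | add x y hx hy => simp [hx, hy]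

lemma evalMap_pi_bijective (h : Function.Bijective (LinearMap.lsmul R C)) (k : ℕ) :
    Function.Bijective (evalMap R C (Fin k → C)) := by
  classical
  let σ : (Fin k → C) →ₗ[R] TensorProduct R C (C →ₗ[R] (Fin k → C)) :=
    ∑ j, (TensorProduct.mk R C _).flip (LinearMap.single R (fun _ => C) j) ∘ₗ LinearMap.proj j
  have h1 (v : Fin k → C) : σ v = ∑ j, TensorProduct.tmul R (v j) (LinearMap.single R _ j) := by
    simp [σ, LinearMap.sum_apply]
  have h2 (v : Fin k → C) : evalMap R C _ (σ v) = v := by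
    rw [h1, map_sum]
    simp only [evalMap_tmul, LinearMap.coe_single]
    exact LinearMap.sum_single_apply _ v
  have h3 : Function.Surjective σ := by
    rw [← LinearMap.range_eq_top, eq_top_iff, ← TensorProduct.span_tmul_eq_top, Submodule.span_le]
    rintro _ ⟨c, x, rfl⟩
    obtain ⟨y, rfl⟩ := (piHomothety_bijective h k).2 x
    refine ⟨fun j => y j • c, ?_⟩
    have hy : piHomothety R C k y = ∑ j, y j • LinearMap.single R (fun _ => C) j := by
      ext c i
      simp [piHomothety_apply, LinearMap.sum_apply, Pi.single_apply]
    rw [h1, hy, TensorProduct.tmul_sum]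
    simp [TensorProduct.smul_tmul]
  refine ⟨fun a b hab => ?_, fun v => ⟨_, h2 v⟩⟩
  obtain ⟨v, rfl⟩ := h3 a
  obtain ⟨w, rfl⟩ := h3 b
  rw [h2, h2] at hab
  rw [hab]

lemma compRight_exact (C : Type u) [AddCommGroup C] [Module R C] {ι : M →ₗ[R] B} {g : B →ₗ[R] Z}
    (hι : Function.Injective ι) (hx : Function.Exact ι g) :
    Function.Exact (ι.compRight R : (C →ₗ[R] M) →ₗ[R] _) (g.compRight R) := by
  intro φ
  constructor
  · intro h
    have hm (c : C) : φ c ∈ LinearMap.range ι := (hx _).1 (LinearMap.congr_fun h c)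
    let e := LinearEquiv.ofInjective ι hι
    refine ⟨e.symm.toLinearMap ∘ₗ φ.codRestrict _ hm, LinearMap.ext fun c => ?_⟩
    exact congrArg Subtype.val (e.apply_symm_apply ⟨_, hm c⟩)
  · rintro ⟨x, rfl⟩
    exact LinearMap.ext fun c => hx.apply_apply_eq_zero (x c)

lemma evalMap_bijective_of_exact {ι : M →ₗ[R] B} {g : B →ₗ[R] Z} (hι : Function.Injective ι)
    (hg : Function.Surjective g) (hx : Function.Exact ι g) (hE : EV R C M 1)
    (hM : Function.Bijective (evalMap R C M)) (hB : Function.Bijective (evalMap R C B)) :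
    Function.Bijective (evalMap R C Z) := by
  have hs : Function.Surjective (g.compRight R : (C →ₗ[R] B) →ₗ[R] _) := ev_one_lift hι hg hx hE
  constructor
  · rw [injective_iff_map_eq_zero]
    intro t ht
    obtain ⟨s, rfl⟩ := LinearMap.lTensor_surjective C hs t
    rw [evalMap_naturality] at ht
    obtain ⟨m, hm⟩ := (hx _).1 ht
    obtain ⟨w, rfl⟩ := hM.2 m
    rw [← evalMap_naturality] at hm
    rw [← hB.1 hm, ← LinearMap.comp_apply, ← LinearMap.lTensor_comp,
      (compRight_exact C hι hx).linearMap_comp_eq_zero, LinearMap.lTensor_zero,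
      LinearMap.zero_apply]
  · intro z
    obtain ⟨b, rfl⟩ := hg z
    obtain ⟨s, rfl⟩ := hB.2 b
    exact ⟨_, evalMap_naturality g s⟩

lemma CPush.hom [IsNoetherianRing R] (hC : SD R C) {n : ℕ} (h : CPush R C n M)
    (hE : ∀ i, EV R C M (i + 1)) (hM : Function.Bijective (evalMap R C M)) :
    CPush R R n (C →ₗ[R] M) := by
  have := hC.finite
  induction n generalizing M with
  | zero => trivial
  | succ n ih =>
    obtain ⟨k, Z, ι, g, hι, hg, hx, hs, hZ⟩ := h
    let F := LinearEquiv.ofBijective _ (piHomothety_bijective hC.homothety k)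
    let H := LinearEquiv.ofBijective _ hC.homothety
    have hex := compRight_exact C hι hx
    have hsg : Function.Surjective (g.compRight R : (C →ₗ[R] (Fin k → C)) →ₗ[R] _) :=
      ev_one_lift hι hg hx (hE 0)
    refine ⟨k, ModuleCat.of R (C →ₗ[R] Z), F.symm.toLinearMap ∘ₗ ι.compRight R,
      g.compRight R ∘ₗ F.toLinearMap,
      F.symm.injective.comp fun a b hab => LinearMap.ext fun c => hι (LinearMap.congr_fun hab c),
      hsg.comp F.surjective, fun y => ?_,
      fun ψ => ?_, ?_⟩
    · refine (hex (F y)).trans ⟨fun ⟨x, h⟩ => ⟨x, ?_⟩, fun ⟨x, h⟩ => ⟨x, ?_⟩⟩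
      · exact F.symm_apply_eq.2 h
      · exact F.symm_apply_eq.1 h
    · let e := LinearEquiv.ofBijective _ hM
      obtain ⟨φ, hφ⟩ := hs (TensorProduct.lift (LinearMap.lsmul R C ∘ₗ ψ).flip ∘ₗ
        e.symm.toLinearMap)
      refine ⟨H.symm.toLinearMap ∘ₗ φ.compRight R ∘ₗ F.toLinearMap, LinearMap.ext fun x => ?_⟩
      refine H.symm_apply_eq.2 (LinearMap.ext fun c => ?_)
      have h1 : F (F.symm (ι.compRight R x)) = ι.compRight R x := F.apply_symm_apply _
      have h2 : e.symm (x c) = TensorProduct.tmul R c x := e.symm_apply_eq.2 rfl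
      have h3 := LinearMap.congr_fun hφ (x c)
      have h4 : TensorProduct.lift (LinearMap.lsmul R C ∘ₗ ψ).flip (e.symm (x c)) = ψ x • c := by
        rw [h2]
        rfl
      refine Eq.trans ?_ (h3.trans h4)
      exact congrArg (fun y : C →ₗ[R] (Fin k → C) => φ (y c)) h1
    · refine ih hZ (fun i => ev_cov₃ hι hg hx (ev_pi k (hC.ev i)) (hE (i + 1))) ?_
      exact evalMap_bijective_of_exact hι hg hx (hE 0) hM (evalMap_pi_bijective hC.homothety k)
end

section
variable {R : Type u} [CommRing R] [IsNoetherianRing R] {W N A B C D : Type u}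
  [AddCommGroup W] [Module R W] [AddCommGroup N] [Module R N] [AddCommGroup A] [Module R A]
  [AddCommGroup B] [Module R B] [AddCommGroup C] [Module R C] [AddCommGroup D] [Module R D]

lemma subsingleton_hom_of_dat [Module.Finite R W] [Module.Finite R N]
    (h : ∀ (p : Ideal R) [p.IsPrime], Nontrivial (LocalizedModule p.primeCompl W) → DAt p N 1) :
    Subsingleton (W →ₗ[R] N) := by
  have key (φ : W →ₗ[R] N) : φ = 0 := by
    have : Subsingleton (LinearMap.range φ) := by
      refine subsingleton_of_dat_one (R := R) fun p _ => ?_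
      rcases subsingleton_or_nontrivial (LocalizedModule p.primeCompl W) with hW | hW
      · have := (LocalizedModule.map_surjective p.primeCompl φ.rangeRestrict
          φ.surjective_rangeRestrict).subsingleton
        exact fun i _ => ev_subsingleton_right i
      · exact DGE.of_injective (LocalizedModule.map_injective p.primeCompl _
          (Submodule.injective_subtype (LinearMap.range φ))) (h p hW)
    exact LinearMap.range_eq_bot.1 ((Submodule.subsingleton_iff_eq_bot).1 this)
  exact ⟨fun a b => (key a).trans (key b).symm⟩

lemma ev_of_dat_support [Module.Finite R W] [Module.Finite R N] {t : ℕ}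
    (h : ∀ (p : Ideal R) [p.IsPrime], Nontrivial (LocalizedModule p.primeCompl W) → DAt p N t)
    (i : ℕ) (hi : i < t) : EV R W N i := by
  induction i generalizing t N with
  | zero =>
    exact ev_zero_iff.2 (subsingleton_hom_of_dat fun p _ hp => DGE.mono (h p hp) (by omega))
  | succ i ih =>
    obtain ⟨t, rfl⟩ : ∃ s, t = s + 1 := ⟨t - 1, by omega⟩
    obtain ⟨x, hx, hr⟩ := IsSMulRegular.subsingleton_linearMap_iff.1
      (subsingleton_hom_of_dat fun p _ hp => DGE.mono (h p hp) (by omega : 1 ≤ t + 1))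
    refine ev_succ_of_smul hr (Submodule.mkQ_surjective _) (exact_lsmul_mkQ N x) hx
      (ih (fun p _ hp => ?_) (by omega : i < t))
    exact dge_right (LocalizedModule.map_injective p.primeCompl (LinearMap.lsmul R N x) hr)
      (LocalizedModule.map_surjective p.primeCompl _ (Submodule.mkQ_surjective _))
      (loc_exact p.primeCompl (exact_lsmul_mkQ N x)) (DGE.mono (h p hp) (by omega)) (h p hp)

/-- If `Ext¹(D, C)` vanishes after localization, then every map `A → C` extends to `B` up to
a denominator. -/
lemma exists_smul_extension [Module.Finite R A] [Module.Finite R B] (S : Submonoid R)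
    {f : A →ₗ[R] B} {g : B →ₗ[R] D}
    (hf : Function.Injective f) (hg : Function.Surjective g) (hx : Function.Exact f g)
    (h : EV (Localization S) (LocalizedModule S D) (LocalizedModule S C) 1) (φ : A →ₗ[R] C) :
    ∃ (s : S) (θ : B →ₗ[R] C), θ ∘ₗ f = (s : R) • φ := by
  obtain ⟨ψ, hψ⟩ := ev_one_extend (LocalizedModule.map_injective S f hf)
    (LocalizedModule.map_surjective S g hg) (loc_exact S hx) h (LocalizedModule.map S φ)
  obtain ⟨s, θ, hθ⟩ := loc_hom_lift S ψ
  have hfp := Module.finitePresentation_of_finite R A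
  have h1 : LocalizedModule.map S (θ ∘ₗ f) = LocalizedModule.map S ((s : R) • φ) := by
    rw [loc_map_comp, ← hθ, LinearMap.smul_comp, hψ, map_smul]
  obtain ⟨r, hr⟩ := IsLocalizedModule.exists_of_eq (S := S)
    (f := LocalizedModule.map S (M := A) (N := C)) h1
  refine ⟨r * s, (r : R) • θ, ?_⟩
  rw [LinearMap.smul_comp, Submonoid.coe_mul, mul_smul]
  exact hr
end

section
variable {R : Type u} [CommRing R] [IsNoetherianRing R] {C M N P Q : Type u}
  [AddCommGroup C] [Module R C] [AddCommGroup M] [Module R M] [AddCommGroup N] [Module R N]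
  [AddCommGroup P] [Module R P] [AddCommGroup Q] [Module R Q]

/-- If `Ext¹(M, C)` vanishes after localization, then for a projective presentation
`P → Q → Hom(C, M) → 0` every functional on the image of `P` extends to `Q` up to a
denominator. -/
lemma exists_smul_functional_extension (hC : SD R C) [Module.Finite R Q]
    [Module.Projective R Q]
    (hev : Function.Bijective (evalMap R C M)) (hT : Subsingleton (TorGrp R (C →ₗ[R] M) C 1))
    (S : Submonoid R) (h : EV (Localization S) (LocalizedModule S M) (LocalizedModule S C) 1)
    {f : P →ₗ[R] Q} {g : Q →ₗ[R] (C →ₗ[R] M)} (hg : Function.Surjective g)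
    (hr : LinearMap.range f = LinearMap.ker g) (v : P →ₗ[R] R) (hv : ∀ a, f a = 0 → v a = 0) :
    ∃ (s : S) (y : Q →ₗ[R] R), LinearMap.lcomp R R f y = (s : R) • v := by
  have := hC.finite
  let H := LinearEquiv.ofBijective _ hC.homothety
  have hf (a : P) : f a ∈ LinearMap.ker g := hr ▸ ⟨a, rfl⟩
  let f' : P →ₗ[R] LinearMap.ker g := f.codRestrict _ hf
  have hf' : Function.Surjective f' := by
    rintro ⟨b, hb⟩
    rw [← hr] at hb
    obtain ⟨a, rfl⟩ := hb
    exact ⟨a, rfl⟩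
  obtain ⟨v, rfl⟩ := (lcomp_exact (C := R) (exact_ker_subtype f') hf' v).1
    (LinearMap.ext fun a => hv a (congrArg Subtype.val a.2))
  let j := (LinearMap.ker g).subtype
  have hx : Function.Exact j g := exact_ker_subtype g
  have hex : Function.Exact (j.lTensor C) (evalMap R C M ∘ₗ g.lTensor C) := fun t =>
    (map_eq_zero_iff _ hev.1).trans (lTensor_exact C hx hg t)
  obtain ⟨s, θ, hθ⟩ := exists_smul_extension S
    (lTensor_injective_of_tor hT (Submodule.injective_subtype _) hg hx)
    (g := evalMap R C M ∘ₗ g.lTensor C) (hev.2.comp (LinearMap.lTensor_surjective C hg)) hex h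
    (TensorProduct.lift (LinearMap.lsmul R C ∘ₗ v).flip)
  refine ⟨s, H.symm.toLinearMap ∘ₗ (TensorProduct.curry θ).flip, LinearMap.ext fun a => ?_⟩
  refine H.symm_apply_eq.2 (LinearMap.ext fun c => ?_)
  refine (LinearMap.congr_fun hθ (TensorProduct.tmul R c (f' a))).trans ?_
  exact (mul_smul (s : R) (v (f' a)) c).symm

/-- A submodule agreeing with `V` at all primes of small depth has the same vanishing of
`Ext(-, R)` in low degrees. -/
lemma ev_of_le_of_forall_smul_mem [Module.Finite R M] {I V : Submodule R M} (hle : I ≤ V) {n i : ℕ}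
    (hin : i < n) (hI : EV R I R i)
    (h : ∀ (p : Ideal R) [p.IsPrime], ¬ DRing p n → ∀ v ∈ V, ∃ s ∈ p.primeCompl, s • v ∈ I) :
    EV R V R i := by
  have hW : EV R (V ⧸ LinearMap.range (Submodule.inclusion hle)) R i := by
    refine ev_of_dat_support (t := n) (fun p _ hp => ?_) i hin
    rw [dat_ring_iff]
    by_contra hR
    refine not_subsingleton_iff_nontrivial.2 hp (LocalizedModule.subsingleton_iff.2 fun w => ?_)
    obtain ⟨⟨v, hv⟩, rfl⟩ := Submodule.mkQ_surjective _ w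
    obtain ⟨s, hs, hsv⟩ := h p hR v hv
    refine ⟨s, hs, ?_⟩
    rw [← map_smul, Submodule.mkQ_apply, Submodule.Quotient.mk_eq_zero]
    exact ⟨⟨_, hsv⟩, rfl⟩
  exact ev_con₂ (Submodule.inclusion_injective hle) (Submodule.mkQ_surjective _)
    (LinearMap.exact_map_mkQ_range _) hI hW

/-- `Ext^i(Hom(C, λ_R(C, M)), R)` vanishes for `0 < i < n` if `M` satisfies `(S̃_n)`. -/
lemma Serre.ev_hom_lambda (hC : SD R C) {n : ℕ} (hid : FinInjDimAt R C n) [Module.Finite R M]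
    (hE : ∀ i, EV R C M (i + 1)) (hev : Function.Bijective (evalMap R C M))
    (hT : Subsingleton (TorGrp R (C →ₗ[R] M) C 1)) (hM : Serre R n M)
    (hN : IsLambdaOf R C M N) (i : ℕ) (hi : 0 < i) (hin : i < n) : EV R (C →ₗ[R] N) R i := by
  have := hC.finite
  obtain ⟨pres, κ, hκ, hr⟩ := hN.exists_embedding
  have := pres.finite₀
  have := pres.proj₀
  have := pres.finite₁
  have := pres.proj₁
  obtain ⟨V, ⟨e⟩, -, hV0, hV⟩ := homEquivComap hC.homothety hκ hr
  have hX : CPush R R n (C →ₗ[R] M) := (hM.cpush hC hid).hom hC hE hev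
  have hR : SD R R := SD.self
  have hP (j : ℕ) : EV R (pres.P₀ →ₗ[R] R) R (j + 1) := hR.ev_dual_projective j
  have hx := lcomp_rangeRestrict_exact (C := R) (exact_of_presentation pres.exact) pres.surj
  have hI : EV R (LinearMap.range (LinearMap.lcomp R R pres.f)) R i :=
    hX.ev_coker hR hP pres.surj (LinearMap.surjective_rangeRestrict _) hx i hi hin
  have hle : LinearMap.range (LinearMap.lcomp R R pres.f) ≤ V := by
    rintro _ ⟨y, rfl⟩
    exact hV y
  refine (ev_of_le_of_forall_smul_mem hle hin hI fun p _ hR v hv => ?_).congr_left e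
  obtain ⟨s, y, hy⟩ := exists_smul_functional_extension hC hev hT p.primeCompl
    ((hM.deep p hR).ev (hid p hR) 0) pres.surj pres.exact v (hV0 v hv)
  exact ⟨s, s.2, y, hy⟩
end

end Paper

open Paper in
/-- Corollary 4.8: for a semidualizing `C` with `id_{R_p}(C_p) < ∞`
for all `p ∈ X^{n-1}(R)` and `M ∈ B_C` horizontally linked with respect to `C`,
the conditions `(S̃_n)`, "`M` is an `n`-th `C`-syzygy",
"`Ext^i_R(λ_R(C,M), C) = 0` for `0 < i < n`" and
"`Ext^i_{P_C}(λ_R(C,M), C) ≅ Ext^i_R(Hom_R(C,λ_R(C,M)), R) = 0` for `0 < i < n`"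
are all equivalent. -/
theorem stmt_13 (R : Type u) [CommRing R] [IsNoetherianRing R]
    (hsemiperf : IsSemiperfectRing R)
    (C : Type u) [AddCommGroup C] [Module R C] (hC : IsSemidualizing R C)
    (n : ℕ) (hn : 0 < n)
    (hid : ∀ (p : Ideal R) (_ : p.IsPrime), ringDepthAt R p + 1 ≤ (n : ℕ∞) →
      HasFiniteInjDim (Localization.AtPrime p) (LocalizedModule p.primeCompl C))
    (M : Type u) [AddCommGroup M] [Module R M] [Module.Finite R M]
    (hB : MemBass R C M) (hlink : IsHorizontallyLinked R C M) :
    -- (i) ↔ (ii)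
    ((SerreTilde R n M ↔ IsNthCSyzygy R n C M) ∧
    -- (i) ↔ (iii)
     (SerreTilde R n M ↔
       (∀ (N : Type u) [AddCommGroup N] [Module R N], IsLambdaOf R C M N →
         ∀ i : ℕ, 0 < i → i < n → Subsingleton (ExtGrp R N C i))) ∧
    -- (i) ↔ (iv)
     (SerreTilde R n M ↔
       (∀ (N : Type u) [AddCommGroup N] [Module R N], IsLambdaOf R C M N →
         ∀ i : ℕ, 0 < i → i < n → Subsingleton (ExtGrp R (C →ₗ[R] N) R i)))) := by
  have hC' : SD R C := ⟨hC.1, hC.2.1, fun i => (ev_iff_extGrp _).2 (hC.2.2 _ (Nat.succ_pos i))⟩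
  have hid' : FinInjDimAt R C n := finInjDimAt_of hid
  have hE (i : ℕ) : EV R C M (i + 1) := (ev_iff_extGrp _).2 (hB.2.2 _ (Nat.succ_pos i))
  have hT := hB.2.1 1 one_pos
  obtain ⟨L, hML, hLM⟩ := hlink
  rw [serreTilde_iff]
  refine ⟨⟨fun h => ?_, fun h => ?_⟩, ⟨fun h N _ _ hN i hi hin => ?_, fun h => ?_⟩,
    ⟨fun h N _ _ hN i hi hin => ?_, fun h => ?_⟩⟩
  · exact (h.cpush hC' hid').isNthCSyzygyAux n (ModuleCat.of R M)
  · exact serre_of_isNthCSyzygyAux hC'.gdeep n (ModuleCat.of R M) h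
  · exact (ev_iff_extGrp i).1 (h.ev_lambda hC' hid' hE hN i hi hin)
  · exact serre_of_ev_lambda hC' hE hML hLM fun i hi hin => (ev_iff_extGrp i).2 (h L hML i hi hin)
  · exact (ev_iff_extGrp i).1 (h.ev_hom_lambda hC' hid' hE hB.1 hT hN i hi hin)
  · exact serre_of_ev_hom_lambda hC' hE hLM fun i hi hin => (ev_iff_extGrp i).2 (h L hML i hi hin)
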